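/- Let n ≥ 2 and 2n/(n−1) ≤ p < ∞. Suppose there is 1/p− local smoothing for the half-wave propagator: for every σ < 1/p there is a constant C_σ with (∫₁² ‖⟨D⟩^{σ−s̄_p} e^{it√(−Δ)} f‖^p_{L^p(ℝⁿ)} dt)^{1/p} ≤ C_σ‖f‖_{L^p(ℝⁿ)} for all f ∈ S(ℝⁿ). Then for every δ > δ(p) := n(1/2 − 1/p) − 1/2 there is a constant C such that the Bochner–Riesz estimate ‖S^δ f‖_{L^p(ℝⁿ)} ≤ C‖f‖_{L^p(ℝⁿ)} holds for all f ∈ S(ℝⁿ). -/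

import Mathlib

open MeasureTheory
open scoped RealInnerProductSpace ENNReal

noncomputable section

/-- `ℝⁿ` as a euclidean space. -/
abbrev V (n : ℕ) := EuclideanSpace ℝ (Fin n)

/-- The Fourier transform `f̂(ξ) = ∫_{ℝⁿ} e^{−i⟨y,ξ⟩} f(y) dy`. -/
def FT {n : ℕ} (f : V n → ℂ) (ξ : V n) : ℂ :=
  ∫ y : V n, Complex.exp (-(Complex.I * ((⟪y, ξ⟫ : ℝ) : ℂ))) * f y

/-- The Bessel potential `⟨D⟩^s g (x) = (2π)^{−n} ∫ e^{i⟨x,ξ⟩}(1+|ξ|²)^{s/2} ĝ(ξ) dξ`. -/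
def besselD {n : ℕ} (s : ℝ) (g : V n → ℂ) (x : V n) : ℂ :=
  ((((2 * Real.pi) ^ n)⁻¹ : ℝ) : ℂ) *
    ∫ ξ : V n, Complex.exp (Complex.I * ((⟪x, ξ⟫ : ℝ) : ℂ)) *
      (((1 + ‖ξ‖ ^ 2) ^ (s / 2) : ℝ) : ℂ) * FT g ξ

/-- The regularity exponent `s̄_p = (n−1)|1/2 − 1/p|`. -/
def sBar (n : ℕ) (p : ℝ) : ℝ := (n - 1) * |1 / 2 - 1 / p|

/-- The half-wave propagator
`e^{it√(−Δ)}f(x) = (2π)^{−n} ∫ e^{i(⟨x,ξ⟩+t|ξ|)} f̂(ξ) dξ`. -/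
def halfWave {n : ℕ} (t : ℝ) (f : V n → ℂ) (x : V n) : ℂ :=
  ((((2 * Real.pi) ^ n)⁻¹ : ℝ) : ℂ) *
    ∫ ξ : V n, Complex.exp (Complex.I * (((⟪x, ξ⟫ + t * ‖ξ‖ : ℝ)) : ℂ)) * FT f ξ

/-- `r₊^δ := r^δ` for `r > 0` and `0` for `r ≤ 0`. -/
def posRpow (r δ : ℝ) : ℝ := if 0 < r then r ^ δ else 0

/-- The Bochner–Riesz operator
`S_t^δ f(x) = (2π)^{−n} ∫ e^{i⟨x,ξ⟩} (1−t|ξ|)₊^δ f̂(ξ) dξ`. -/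
def bochnerRiesz {n : ℕ} (δ t : ℝ) (f : V n → ℂ) (x : V n) : ℂ :=
  ((((2 * Real.pi) ^ n)⁻¹ : ℝ) : ℂ) *
    ∫ ξ : V n, Complex.exp (Complex.I * ((⟪x, ξ⟫ : ℝ) : ℂ)) *
      ((posRpow (1 - t * ‖ξ‖) δ : ℝ) : ℂ) * FT f ξ

open scoped FourierTransform SchwartzMap ContDiff

/-- The inverse Fourier transform in the normalisation dual to `FT`. -/
def invFT {n : ℕ} (G : V n → ℂ) (x : V n) : ℂ :=
  ((((2 * Real.pi) ^ n)⁻¹ : ℝ) : ℂ) *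
    ∫ ξ : V n, Complex.exp (Complex.I * ((⟪x, ξ⟫ : ℝ) : ℂ)) * G ξ

/-- The Fourier multiplier operator with symbol `m`. -/
def mult {n : ℕ} (m : V n → ℂ) (f : V n → ℂ) : V n → ℂ :=
  invFT fun ξ => m ξ * FT f ξ

lemma FT_eq_fourier {n : ℕ} (f : V n → ℂ) (ξ : V n) :
    FT f ξ = 𝓕 f ((2 * Real.pi)⁻¹ • ξ) := by
  have h : (Real.pi : ℂ) ≠ 0 := by exact_mod_cast Real.pi_ne_zero
  rw [Real.fourier_eq']
  refine integral_congr_ae (.of_forall fun y => ?_)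
  simp only [smul_eq_mul, inner_smul_right]
  congr 2
  push_cast
  field_simp

lemma invFT_eq_fourierInv {n : ℕ} (G : V n → ℂ) (x : V n) :
    invFT G x = 𝓕⁻ (fun η => G ((2 * Real.pi) • η)) x := by
  rw [Real.fourierInv_eq', invFT]
  have h := Measure.integral_comp_smul (volume : Measure (V n))
    (fun ξ => Complex.exp (Complex.I * ((⟪x, ξ⟫ : ℝ) : ℂ)) * G ξ) (2 * Real.pi)
  rw [finrank_euclideanSpace_fin, abs_of_pos (by positivity)] at h
  rw [← Complex.real_smul, ← h]
  refine integral_congr_ae (.of_forall fun y => ?_)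
  simp only [smul_eq_mul, inner_smul_right, real_inner_comm]
  congr 2
  push_cast
  ring

/-- The dilation of Schwartz functions by a nonzero factor. -/
def dilS {n : ℕ} (c : ℝ) (hc : c ≠ 0) : 𝓢(V n, ℂ) →L[ℂ] 𝓢(V n, ℂ) :=
  SchwartzMap.compCLMOfContinuousLinearEquiv ℂ
    (ContinuousLinearEquiv.smulLeft (Units.mk0 c hc) : V n ≃L[ℝ] V n)

lemma dilS_apply {n : ℕ} (c : ℝ) (hc : c ≠ 0) (f : 𝓢(V n, ℂ)) (x : V n) :
    dilS c hc f x = f (c • x) := rfl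

/-- `FT` as a map of Schwartz space. -/
def FTS {n : ℕ} (f : 𝓢(V n, ℂ)) : 𝓢(V n, ℂ) :=
  dilS (2 * Real.pi)⁻¹ (by positivity) (𝓕 f)

lemma FTS_apply {n : ℕ} (f : 𝓢(V n, ℂ)) (ξ : V n) : FTS f ξ = FT f ξ := by
  rw [FTS, dilS_apply, FT_eq_fourier, SchwartzMap.fourier_coe]

/-- `invFT` as a map of Schwartz space. -/
def invFTS {n : ℕ} : 𝓢(V n, ℂ) →L[ℂ] 𝓢(V n, ℂ) :=
  (FourierTransform.fourierInvCLM ℂ 𝓢(V n, ℂ)).comp (dilS (2 * Real.pi) (by positivity))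

lemma invFTS_apply {n : ℕ} (G : 𝓢(V n, ℂ)) (x : V n) : invFTS G x = invFT G x := by
  rw [invFT_eq_fourierInv]
  simp only [invFTS, ContinuousLinearMap.comp_apply, FourierTransform.fourierInvCLM_apply]
  rw [SchwartzMap.fourierInv_coe]
  rfl

lemma FT_invFTS {n : ℕ} (G : 𝓢(V n, ℂ)) (ξ : V n) : FT (invFTS G) ξ = G ξ := by
  rw [← FTS_apply, FTS, dilS_apply]
  simp only [invFTS, ContinuousLinearMap.comp_apply, FourierTransform.fourierInvCLM_apply]
  rw [FourierTransform.fourier_fourierInv_eq, dilS_apply, smul_smul,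
    mul_inv_cancel₀ (by positivity), one_smul]

lemma continuous_FT {n : ℕ} (f : 𝓢(V n, ℂ)) : Continuous (FT f) := by
  simpa only [← funext (FTS_apply f)] using (FTS f).continuous

lemma contDiff_FT {n : ℕ} (f : 𝓢(V n, ℂ)) : ContDiff ℝ ∞ (FT f) := by
  simpa only [← funext (FTS_apply f)] using (FTS f).smooth ⊤

lemma exists_eLpNorm_one_le {n : ℕ} (S : Set 𝓢(V n, ℂ)) (hb : Bornology.IsVonNBounded ℂ S) :
    ∃ r : ℝ, ∀ G ∈ S, (eLpNorm G 1 volume).toReal ≤ r := by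
  have hb2 := hb.image (SchwartzMap.toLpCLM ℂ ℂ 1 (volume : Measure (V n)))
  obtain ⟨r, hr⟩ := (NormedSpace.isVonNBounded_iff' ℂ).1 hb2
  refine ⟨r, fun G hG => ?_⟩
  have h := hr _ (Set.mem_image_of_mem _ hG)
  rwa [SchwartzMap.toLpCLM_apply, SchwartzMap.norm_toLp] at h

lemma exists_lintegral_invFT_le {n : ℕ} (S : Set 𝓢(V n, ℂ))
    (hS : ∀ k l : ℕ, ∃ r : ℝ, ∀ G ∈ S, SchwartzMap.seminorm ℂ k l G ≤ r) :
    ∃ A : ℝ≥0∞, A ≠ ⊤ ∧ ∀ G ∈ S, ∫⁻ x, ‖invFT G x‖ₑ ≤ A := by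
  have hb : Bornology.IsVonNBounded ℂ S := by
    rw [(schwartz_withSeminorms ℂ (V n) ℂ).isVonNBounded_iff_seminorm_bounded]
    intro i
    obtain ⟨r, hr⟩ := hS i.1 i.2
    exact ⟨max r 0 + 1, by positivity, fun G hG =>
      (hr G hG).trans_lt ((le_max_left r 0).trans_lt (lt_add_one _))⟩
  obtain ⟨r, hr⟩ := exists_eLpNorm_one_le _ (hb.image invFTS)
  refine ⟨ENNReal.ofReal r, ENNReal.ofReal_ne_top, fun G hG => ?_⟩
  have h := hr _ (Set.mem_image_of_mem _ hG)
  have h2 : ∫⁻ x, ‖invFT G x‖ₑ = eLpNorm (invFTS G) 1 volume := by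
    simp only [eLpNorm_one_eq_lintegral_enorm, invFTS_apply]
  have h3 : eLpNorm (invFTS G) 1 volume ≠ ⊤ := ((invFTS G).memLp 1 volume).eLpNorm_ne_top
  rw [h2, ← ENNReal.ofReal_toReal h3]
  exact ENNReal.ofReal_le_ofReal h

lemma norm_iteratedFDeriv_partial_le {E F : Type*} [NormedAddCommGroup E] [NormedSpace ℝ E]
    [NormedAddCommGroup F] [NormedSpace ℝ F] {M : ℝ × E → F} (hM : ContDiff ℝ ∞ M) (l : ℕ)
    (s : ℝ) (x : E) :
    ‖iteratedFDeriv ℝ l (fun ξ => M (s, ξ)) x‖ ≤ ‖iteratedFDeriv ℝ l M (s, x)‖ := by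
  have h1 : (fun ξ => M (s, ξ)) =
      (fun z => M ((s, 0) + z)) ∘ (ContinuousLinearMap.inr ℝ ℝ E) := by
    ext ξ; simp
  have h2 : ContDiff ℝ ∞ fun z => M ((s, 0) + z) := hM.comp (contDiff_const.add contDiff_id)
  rw [h1, ContinuousLinearMap.iteratedFDeriv_comp_right _ h2 x (i := l) (by exact_mod_cast le_top),
    iteratedFDeriv_comp_add_left]
  refine (ContinuousMultilinearMap.norm_compContinuousLinearMap_le _ _).trans ?_
  simp only [ContinuousLinearMap.inr_apply, Prod.mk_add_mk, add_zero, zero_add]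
  refine mul_le_of_le_one_right (norm_nonneg _) (Finset.prod_le_one (fun _ _ => norm_nonneg _)
    fun _ _ => ContinuousLinearMap.norm_inr_le_one _ _ _)

lemma exists_seminorm_family_le {n : ℕ} {M : ℝ × V n → ℂ} (hM : ContDiff ℝ ∞ M) {R : ℝ}
    (hR : ∀ s x, R < ‖x‖ → M (s, x) = 0) (k l : ℕ) :
    ∃ r : ℝ, 0 ≤ r ∧ ∀ s ∈ Set.Icc (-1 : ℝ) 1, ∀ x,
      ‖x‖ ^ k * ‖iteratedFDeriv ℝ l (fun ξ => M (s, ξ)) x‖ ≤ r := by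
  have hcont : Continuous fun z : ℝ × V n => ‖z.2‖ ^ k * ‖iteratedFDeriv ℝ l M z‖ := by
    have := hM.continuous_iteratedFDeriv (m := l) (by exact_mod_cast le_top)
    fun_prop
  obtain ⟨r, hr⟩ := ((isCompact_Icc (a := (-1 : ℝ)) (b := 1)).prod
    (isCompact_closedBall (0 : V n) R)).exists_bound_of_continuousOn hcont.continuousOn
  refine ⟨max r 0, le_max_right _ _, fun s hs x => ?_⟩
  by_cases hx : ‖x‖ ≤ R
  · refine le_trans ?_ (le_max_left r 0)
    refine le_trans ?_ ((le_abs_self _).trans (hr (s, x) ⟨hs, by simpa using hx⟩))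
    exact mul_le_mul_of_nonneg_left (norm_iteratedFDeriv_partial_le hM l s x) (by positivity)
  · have : (fun ξ => M (s, ξ)) =ᶠ[nhds x] fun _ => 0 := by
      filter_upwards [continuous_norm.continuousAt.eventually (lt_mem_nhds (not_le.1 hx))]
        with y hy using hR s y hy
    rw [(Filter.EventuallyEq.iteratedFDeriv (𝕜 := ℝ) this l).eq_of_nhds]
    simp

lemma hasCompactSupport_of_norm {E : Type*} [NormedAddCommGroup E] [ProperSpace E] {m : E → ℂ}
    {R : ℝ} (hR : ∀ x, R < ‖x‖ → m x = 0) : HasCompactSupport m := by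
  refine HasCompactSupport.of_support_subset_isCompact (isCompact_closedBall 0 R) fun x hx => ?_
  rw [mem_closedBall_zero_iff]
  by_contra! h
  exact hx (hR x h)

/-- The kernels of a smooth compactly supported family of symbols are uniformly integrable. -/
lemma exists_lintegral_invFT_family_le {n : ℕ} {M : ℝ × V n → ℂ} (hM : ContDiff ℝ ∞ M) {R : ℝ}
    (hR : ∀ s x, R < ‖x‖ → M (s, x) = 0) :
    ∃ A : ℝ≥0∞, A ≠ ⊤ ∧ ∀ s ∈ Set.Icc (-1 : ℝ) 1, ∫⁻ x, ‖invFT (fun ξ => M (s, ξ)) x‖ₑ ≤ A := by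
  have hsm (s : ℝ) : ContDiff ℝ ∞ fun ξ => M (s, ξ) := hM.comp (contDiff_prodMk_right s)
  have hcs (s : ℝ) : HasCompactSupport fun ξ => M (s, ξ) := hasCompactSupport_of_norm (hR s)
  set S : ℝ → 𝓢(V n, ℂ) := fun s => (hcs s).toSchwartzMap (hsm s) with hSdef
  have hS (s : ℝ) : ⇑(S s) = fun ξ => M (s, ξ) := rfl
  clear_value S
  obtain ⟨A, hA, h⟩ := exists_lintegral_invFT_le (S '' Set.Icc (-1 : ℝ) 1) (by
      intro k l
      obtain ⟨r, hr0, hr⟩ := exists_seminorm_family_le hM hR k l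
      refine ⟨r, ?_⟩
      rintro _ ⟨s, hs, rfl⟩
      refine SchwartzMap.seminorm_le_bound _ _ _ _ hr0 fun x => ?_
      rw [hS]
      exact hr s hs x)
  refine ⟨A, hA, fun s hs => ?_⟩
  have := h _ (Set.mem_image_of_mem S hs)
  rwa [hS] at this

lemma lintegral_mul_rpow_le {Ω : Type*} [MeasurableSpace Ω] {μ : Measure Ω} {p : ℝ} (hp : 1 < p)
    {k g : Ω → ℝ≥0∞} (hk : Measurable k) (hg : Measurable g) :
    (∫⁻ x, k x * g x ∂μ) ^ p ≤ (∫⁻ x, k x ∂μ) ^ (p - 1) * ∫⁻ x, k x * g x ^ p ∂μ := by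
  have hpq := Real.HolderConjugate.conjExponent hp
  set q := p.conjExponent
  have hp0 : 0 < p := by linarith
  have hq0 : 0 < q := hpq.symm.pos
  have h := ENNReal.lintegral_mul_le_Lp_mul_Lq μ hpq.symm (f := fun x => k x ^ (1 / q))
    (g := fun x => k x ^ (1 / p) * g x) (hk.pow_const _).aemeasurable
    ((hk.pow_const _).mul hg).aemeasurable
  have h1 : ∀ x, ((fun x => k x ^ (1 / q)) * fun x => k x ^ (1 / p) * g x) x = k x * g x := by
    intro x
    have : 1 / q + 1 / p = 1 := by simpa using hpq.symm.inv_add_inv_eq_one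
    simp only [Pi.mul_apply, ← mul_assoc]
    rw [← ENNReal.rpow_add_of_nonneg _ _ (by positivity) (by positivity), this, ENNReal.rpow_one]
  simp only [h1] at h
  have h2 : ∀ x, (k x ^ (1 / q)) ^ q = k x := fun x => by
    rw [← ENNReal.rpow_mul, one_div_mul_cancel hq0.ne', ENNReal.rpow_one]
  have h3 : ∀ x, (k x ^ (1 / p) * g x) ^ p = k x * g x ^ p := fun x => by
    rw [ENNReal.mul_rpow_of_nonneg _ _ hp0.le, ← ENNReal.rpow_mul, one_div_mul_cancel hp0.ne',
      ENNReal.rpow_one]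
  simp only [h2, h3] at h
  refine (ENNReal.rpow_le_rpow h hp0.le).trans_eq ?_
  rw [ENNReal.mul_rpow_of_nonneg _ _ hp0.le, ← ENNReal.rpow_mul, ← ENNReal.rpow_mul,
    one_div_mul_cancel hp0.ne', ENNReal.rpow_one]
  congr 2
  rw [one_div, inv_mul_eq_div]
  have := hpq.sub_one_mul_conj
  field_simp
  linarith

/-- The `p`-th power of the `L^p` norm. -/
def lpMass {n : ℕ} (p : ℝ) (g : V n → ℂ) : ℝ≥0∞ := ∫⁻ x, ‖g x‖ₑ ^ p

lemma eLpNorm_eq_lpMass {n : ℕ} {p : ℝ} (hp : 0 < p) (g : V n → ℂ) :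
    eLpNorm g (ENNReal.ofReal p) volume = lpMass p g ^ (1 / p) := by
  rw [eLpNorm_eq_lintegral_rpow_enorm_toReal (by simpa using hp) ENNReal.ofReal_ne_top,
    ENNReal.toReal_ofReal hp.le, lpMass]

lemma lpMass_add_le {n : ℕ} {p : ℝ} (hp : 1 ≤ p) {g h : V n → ℂ} (hg : Measurable g) :
    lpMass p (fun x => g x + h x) ≤ 2 ^ (p - 1) * (lpMass p g + lpMass p h) := by
  unfold lpMass
  rw [← lintegral_add_left (by fun_prop), ← lintegral_const_mul' _ _ (by finiteness)]
  refine lintegral_mono fun x => ?_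
  exact (ENNReal.rpow_le_rpow (enorm_add_le _ _) (by linarith)).trans
    (ENNReal.rpow_add_le_mul_rpow_add_rpow _ _ hp)

lemma norm_cexp_I_mul (x : ℝ) : ‖Complex.exp (Complex.I * (x : ℂ))‖ = 1 := by
  rw [mul_comm, Complex.norm_exp_ofReal_mul_I]

lemma continuous_invFT {n : ℕ} {m : V n → ℂ} (hm : Integrable m) : Continuous (invFT m) := by
  unfold invFT
  refine continuous_const.mul ?_
  refine continuous_of_dominated (bound := fun ξ => ‖m ξ‖) (fun x => ?_) (fun x => ?_) hm.norm ?_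
  · exact (Continuous.aestronglyMeasurable (by fun_prop)).mul hm.1
  · exact .of_forall fun ξ => by rw [norm_mul, norm_cexp_I_mul, one_mul]
  · exact .of_forall fun ξ => by fun_prop

lemma mult_eq_convolution {n : ℕ} {m : V n → ℂ} (hm : Integrable m) (f : 𝓢(V n, ℂ)) (x : V n) :
    mult m f x = ∫ y, invFT m (x - y) * f y := by
  have h : Integrable (Function.uncurry fun ξ y : V n =>
      Complex.exp (Complex.I * ((⟪x - y, ξ⟫ : ℝ) : ℂ)) * (m ξ * f y)) (volume.prod volume) := by
    have h0 := hm.mul_prod f.integrable (μ := volume) (ν := volume)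
    refine h0.norm.mono' ((Continuous.aestronglyMeasurable (by fun_prop)).mul h0.1)
      (.of_forall fun z => ?_)
    simp only [Function.uncurry, norm_mul, norm_cexp_I_mul, one_mul, le_refl]
  have h1 := integral_integral_swap h
  unfold mult invFT FT
  simp only [mul_assoc, integral_const_mul]
  congr 1
  calc _ = ∫ ξ, ∫ y, Complex.exp (Complex.I * ((⟪x - y, ξ⟫ : ℝ) : ℂ)) * (m ξ * f y) := by
        refine integral_congr_ae (.of_forall fun ξ => ?_)
        simp only [← integral_const_mul]
        refine integral_congr_ae (.of_forall fun y => ?_)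
        beta_reduce
        rw [inner_sub_left, Complex.ofReal_sub, mul_sub, sub_eq_add_neg, Complex.exp_add]
        ring
    _ = _ := by
        rw [h1]
        refine integral_congr_ae (.of_forall fun y => ?_)
        simp only [← integral_mul_const]
        simp only [mul_assoc]

lemma lpMass_mult_le {n : ℕ} {p : ℝ} (hp : 1 < p) {m : V n → ℂ} (hm : Integrable m)
    (f : 𝓢(V n, ℂ)) :
    lpMass p (mult m f) ≤ (∫⁻ x, ‖invFT m x‖ₑ) ^ p * lpMass p f := by
  have hK : Continuous (invFT m) := continuous_invFT hm
  have hf : Continuous f := f.continuous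
  have hm1 (x : V n) : Measurable fun y => ‖invFT m (x - y)‖ₑ :=
    (hK.comp (continuous_sub_left x)).enorm.measurable
  have hm2 (y : V n) : Measurable fun x => ‖invFT m (x - y)‖ₑ :=
    (hK.comp (continuous_sub_right y)).enorm.measurable
  set A := ∫⁻ x, ‖invFT m x‖ₑ with hA
  have hp0 : 0 < p := by linarith
  calc lpMass p (mult m f)
      ≤ ∫⁻ x, (∫⁻ y, ‖invFT m (x - y)‖ₑ * ‖f y‖ₑ) ^ p := by
        refine lintegral_mono fun x => ENNReal.rpow_le_rpow ?_ hp0.le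
        rw [mult_eq_convolution hm]
        refine (enorm_integral_le_lintegral_enorm _).trans_eq ?_
        simp only [enorm_mul]
    _ ≤ ∫⁻ x, A ^ (p - 1) * ∫⁻ y, ‖invFT m (x - y)‖ₑ * ‖f y‖ₑ ^ p := by
        refine lintegral_mono fun x => ?_
        refine (lintegral_mul_rpow_le hp (hm1 x)
          (by fun_prop)).trans_eq ?_
        rw [lintegral_sub_left_eq_self (fun y => ‖invFT m y‖ₑ) x]
    _ = A ^ (p - 1) * ∫⁻ x, ∫⁻ y, ‖invFT m (x - y)‖ₑ * ‖f y‖ₑ ^ p := by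
        rw [lintegral_const_mul]
        refine Measurable.lintegral_prod_right' (f := fun z : V n × V n =>
          ‖invFT m (z.1 - z.2)‖ₑ * ‖f z.2‖ₑ ^ p) ?_
        fun_prop
    _ = A ^ (p - 1) * ∫⁻ y, A * ‖f y‖ₑ ^ p := by
        rw [lintegral_lintegral_swap (by fun_prop)]
        congr 1
        refine lintegral_congr fun y => ?_
        rw [lintegral_mul_const _ (hm2 y),
          lintegral_sub_right_eq_self (fun x => ‖invFT m x‖ₑ) y]
    _ = A ^ p * lpMass p f := by
        rw [lintegral_const_mul _ (by fun_prop), ← mul_assoc, lpMass]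
        congr 1
        nth_rewrite 2 [← ENNReal.rpow_one A]
        rw [← ENNReal.rpow_add_of_nonneg _ _ (by linarith) zero_le_one, sub_add_cancel]

lemma exists_lpMass_mult_family_le {n : ℕ} {p : ℝ} (hp : 1 < p) {M : ℝ × V n → ℂ}
    (hM : ContDiff ℝ ∞ M) {R : ℝ} (hR : ∀ s x, R < ‖x‖ → M (s, x) = 0) :
    ∃ A : ℝ≥0∞, A ≠ ⊤ ∧ ∀ s ∈ Set.Icc (-1 : ℝ) 1, ∀ f : 𝓢(V n, ℂ),
      lpMass p (mult (fun ξ => M (s, ξ)) f) ≤ A * lpMass p f := by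
  obtain ⟨A, hA, h⟩ := exists_lintegral_invFT_family_le hM hR
  refine ⟨A ^ p, ENNReal.rpow_ne_top_of_nonneg (by linarith) hA, fun s hs f => ?_⟩
  have hint : Integrable fun ξ => M (s, ξ) :=
    (hM.comp (contDiff_prodMk_right s)).continuous.integrable_of_hasCompactSupport
      (hasCompactSupport_of_norm (hR s))
  refine (lpMass_mult_le hp hint f).trans ?_
  gcongr
  exact h s hs

lemma continuous_posRpow {δ : ℝ} (hδ : 0 < δ) : Continuous fun s => posRpow s δ := by
  have : (fun s => posRpow s δ) = fun s => max s 0 ^ δ := by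
    ext s
    unfold posRpow
    split_ifs with h
    · rw [max_eq_left h.le]
    · rw [max_eq_right (not_lt.1 h), Real.zero_rpow hδ.ne']
  rw [this]
  exact (continuous_id.max continuous_const).rpow_const fun _ => .inr hδ.le

lemma posRpow_add_one (δ s : ℝ) : posRpow s (δ + 1) = s * posRpow s δ := by
  unfold posRpow
  split_ifs with h
  · rw [Real.rpow_add_one h.ne', mul_comm]
  · rw [mul_zero]

/-- The gamma density profile `s₊^δ e^{-s}`. -/
def gammaProfile (δ s : ℝ) : ℂ := ((posRpow s δ * Real.exp (-s) : ℝ) : ℂ)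

lemma continuous_gammaProfile {δ : ℝ} (hδ : 0 < δ) : Continuous (gammaProfile δ) :=
  Complex.continuous_ofReal.comp ((continuous_posRpow hδ).mul (by fun_prop))

lemma integrable_gammaProfile {δ : ℝ} (hδ : 0 < δ) : Integrable (gammaProfile δ) := by
  suffices hr : Integrable fun s => posRpow s δ * Real.exp (-s) from hr.ofReal
  have h := integrableOn_rpow_mul_exp_neg_mul_rpow (p := 1) (s := δ) (b := 1) (by linarith)
    one_pos one_pos
  rw [← integrable_indicator_iff measurableSet_Ioi] at h
  refine h.congr (.of_forall fun s => ?_)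
  by_cases hs : 0 < s <;> simp [posRpow, hs, Set.indicator]

lemma gammaProfile_add_one (δ s : ℝ) : gammaProfile (δ + 1) s = s • gammaProfile δ s := by
  simp only [gammaProfile, posRpow_add_one, Complex.real_smul]
  push_cast
  ring

lemma fourier_gammaProfile_eq (δ w : ℝ) : 𝓕 (gammaProfile δ) w =
    ∫ s in Set.Ioi (0 : ℝ),
      ((s ^ δ : ℝ) : ℂ) * Complex.exp (-(1 + 2 * Real.pi * w * Complex.I) * s) := by
  rw [Real.fourier_real_eq_integral_exp_smul, ← integral_indicator measurableSet_Ioi]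
  refine integral_congr_ae (.of_forall fun s => ?_)
  by_cases hs : 0 < s
  · simp only [gammaProfile, posRpow, hs, if_true, Set.indicator, Set.mem_Ioi, smul_eq_mul]
    push_cast
    rw [mul_left_comm, ← Complex.exp_add]
    congr 2
    ring
  · simp [gammaProfile, posRpow, hs, Set.indicator]

lemma integrableOn_rpow_mul_cexp {δ : ℝ} (hδ : 0 < δ) (w : ℝ) :
    IntegrableOn (fun s : ℝ => ((s ^ δ : ℝ) : ℂ) *
      Complex.exp (-(1 + 2 * Real.pi * w * Complex.I) * s)) (Set.Ioi 0) := by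
  have h := integrableOn_rpow_mul_exp_neg_mul_rpow (p := 1) (s := δ) (b := 1) (by linarith)
    one_pos one_pos
  have hc : Continuous fun s : ℝ => ((s ^ δ : ℝ) : ℂ) *
      Complex.exp (-(1 + 2 * Real.pi * w * Complex.I) * s) :=
    (Complex.continuous_ofReal.comp (continuous_id.rpow_const fun _ => .inr hδ.le)).mul
      (by fun_prop)
  refine h.mono' hc.aestronglyMeasurable ?_
  refine (ae_restrict_mem measurableSet_Ioi).mono fun s hs => ?_
  rw [norm_mul, Complex.norm_exp, Complex.norm_real,
    Real.norm_of_nonneg (Real.rpow_nonneg hs.out.le _)]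
  simp

lemma fourier_gammaProfile_add_one {δ : ℝ} (hδ : 0 < δ) (w : ℝ) :
    (δ + 1) * 𝓕 (gammaProfile δ) w =
      (1 + 2 * Real.pi * w * Complex.I) * 𝓕 (gammaProfile (δ + 1)) w := by
  have hI := integrableOn_rpow_mul_cexp hδ w
  have hI' := integrableOn_rpow_mul_cexp (add_pos hδ one_pos) w
  rw [fourier_gammaProfile_eq, fourier_gammaProfile_eq]
  set z : ℂ := 1 + 2 * Real.pi * w * Complex.I with hz
  have hd : ∀ s ∈ Set.Ici (0 : ℝ), HasDerivAt
      (fun s : ℝ => ((s ^ (δ + 1) : ℝ) : ℂ) * Complex.exp (-z * s))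
      ((δ + 1) * (((s ^ δ : ℝ) : ℂ) * Complex.exp (-z * s)) -
        z * (((s ^ (δ + 1) : ℝ) : ℂ) * Complex.exp (-z * s))) s := by
    intro s _
    have h1 := (Real.hasDerivAt_rpow_const (x := s) (p := δ + 1) (.inr (by linarith))).ofReal_comp
    have h2 : HasDerivAt (fun s : ℝ => Complex.exp (-z * s)) (Complex.exp (-z * s) * (-z)) s := by
      have h3 : HasDerivAt (fun s : ℝ => -z * (s : ℂ)) (-z) s := by
        simpa using (Complex.ofRealCLM.hasDerivAt (x := s)).const_mul (-z)
      exact h3.cexp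
    refine (h1.mul h2).congr_deriv ?_
    rw [add_sub_cancel_right]
    push_cast
    ring
  have hlim : Filter.Tendsto (fun s : ℝ => ((s ^ (δ + 1) : ℝ) : ℂ) * Complex.exp (-z * s))
      Filter.atTop (nhds 0) := by
    rw [tendsto_zero_iff_norm_tendsto_zero]
    refine (tendsto_rpow_mul_exp_neg_mul_atTop_nhds_zero (δ + 1) 1 one_pos).congr' ?_
    filter_upwards [Filter.eventually_ge_atTop 0] with s hs
    rw [norm_mul, Complex.norm_exp, Complex.norm_real, Real.norm_of_nonneg (Real.rpow_nonneg hs _)]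
    simp [hz]
  have h := integral_Ioi_of_hasDerivAt_of_tendsto' hd
    ((hI.const_mul _).sub (hI'.const_mul _)) hlim
  rw [integral_sub (hI.const_mul _) (hI'.const_mul _), integral_const_mul, integral_const_mul,
    Real.zero_rpow (by linarith)] at h
  simpa [sub_eq_zero] using h

lemma exists_fourier_gammaProfile_eq {δ : ℝ} (hδ : 0 < δ) : ∃ c : ℂ, ∀ w : ℝ,
    𝓕 (gammaProfile δ) w * (1 + 2 * Real.pi * w * Complex.I) ^ ((δ : ℂ) + 1) = c := by
  set P : ℝ → ℂ := fun w =>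
    𝓕 (gammaProfile δ) w * (1 + 2 * Real.pi * w * Complex.I) ^ ((δ : ℂ) + 1)
  have hP : ∀ w, HasDerivAt P 0 w := by
    intro w
    have h1 := Real.hasDerivAt_fourier (integrable_gammaProfile hδ)
      ((integrable_gammaProfile (add_pos hδ one_pos)).congr
        (.of_forall (gammaProfile_add_one δ))) w
    have h2 : 𝓕 (fun x : ℝ => (-2 * Real.pi * Complex.I * x) • gammaProfile δ x) w =
        (-2 * Real.pi * Complex.I) * 𝓕 (gammaProfile (δ + 1)) w := by
      rw [Real.fourier_real_eq_integral_exp_smul, Real.fourier_real_eq_integral_exp_smul,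
        ← integral_const_mul]
      refine integral_congr_ae (.of_forall fun s => ?_)
      simp only [gammaProfile_add_one, smul_eq_mul, Complex.real_smul]
      ring
    rw [h2] at h1
    have hz0 : (1 + 2 * Real.pi * w * Complex.I : ℂ) ∈ Complex.slitPlane := by
      left; simp
    have h3 : HasDerivAt (fun w : ℝ => (1 + 2 * Real.pi * w * Complex.I : ℂ))
        (2 * Real.pi * Complex.I) w := by
      have := (((Complex.ofRealCLM.hasDerivAt (x := w)).const_mul
        (2 * Real.pi : ℂ)).mul_const Complex.I).const_add 1
      simpa using this
    have h4 := (hasDerivAt_id' (1 + 2 * Real.pi * w * Complex.I : ℂ)).cpow_const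
      (c := (δ : ℂ) + 1) hz0
    have h5 := h1.mul (HasDerivAt.comp w (h₂ := fun z : ℂ => z ^ ((δ : ℂ) + 1))
      (h := fun w : ℝ => (1 + 2 * Real.pi * w * Complex.I : ℂ)) h4 h3)
    refine h5.congr_deriv ?_
    have h6 := fourier_gammaProfile_add_one hδ w
    have hz1 : (1 + 2 * Real.pi * w * Complex.I : ℂ) ≠ 0 := Complex.slitPlane_ne_zero hz0
    simp only [Function.comp, add_sub_cancel_right, mul_one]
    rw [Complex.cpow_add _ _ hz1, Complex.cpow_one]
    linear_combination (2 * Real.pi * Complex.I * (1 + 2 * Real.pi * w * Complex.I) ^ (δ : ℂ)) * h6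
  exact ⟨P 0, fun w => is_const_of_deriv_eq_zero (fun w => (hP w).differentiableAt)
    (fun w => (hP w).deriv) w 0⟩

lemma exists_norm_fourier_gammaProfile_le {δ : ℝ} (hδ : 0 < δ) : ∃ c : ℝ, 0 ≤ c ∧ ∀ w : ℝ,
    ‖𝓕 (gammaProfile δ) w‖ ≤ c * (1 + (2 * Real.pi * w) ^ 2) ^ (-(1 + δ) / 2) := by
  obtain ⟨c, hc⟩ := exists_fourier_gammaProfile_eq hδ
  refine ⟨‖c‖, norm_nonneg _, fun w => ?_⟩
  have h1 : ‖(1 + 2 * Real.pi * w * Complex.I : ℂ)‖ = (1 + (2 * Real.pi * w) ^ 2) ^ (1 / 2 : ℝ) := by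
    rw [← Real.sqrt_eq_rpow]
    have := Complex.norm_add_mul_I 1 (2 * Real.pi * w)
    push_cast at this
    rw [this, one_pow]
  have h2 : ‖(1 + 2 * Real.pi * w * Complex.I : ℂ) ^ ((δ : ℂ) + 1)‖ =
      (1 + (2 * Real.pi * w) ^ 2) ^ ((1 + δ) / 2) := by
    have := Complex.norm_cpow_real (1 + 2 * Real.pi * w * Complex.I) (δ + 1)
    push_cast at this
    rw [this, h1, ← Real.rpow_mul (by positivity)]
    congr 1; ring
  rw [← hc w, norm_mul, h2, mul_assoc, ← Real.rpow_add (by positivity)]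
  ring_nf
  simp

/-- Representation of `(1 - r)₊^δ` as a superposition of oscillations. -/
lemma exists_posRpow_one_sub_eq {δ : ℝ} (hδ : 0 < δ) : ∃ h : ℝ → ℂ, Continuous h ∧
    (∃ c : ℝ, 0 ≤ c ∧ ∀ τ, ‖h τ‖ ≤ c * (1 + τ ^ 2) ^ (-(1 + δ) / 2)) ∧
    ∀ r : ℝ, ((posRpow (1 - r) δ : ℝ) : ℂ) =
      (Real.exp (1 - r) : ℂ) * ∫ τ, h τ * Complex.exp (Complex.I * ((τ * r : ℝ) : ℂ)) := by
  obtain ⟨c, hc0, hc⟩ := exists_norm_fourier_gammaProfile_le hδ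
  set F := 𝓕 (gammaProfile δ) with hF
  have hFc : Continuous F := by
    have := fun w => (Real.hasDerivAt_fourier (integrable_gammaProfile hδ)
      ((integrable_gammaProfile (add_pos hδ one_pos)).congr
        (.of_forall (gammaProfile_add_one δ))) w).continuousAt
    exact continuous_iff_continuousAt.2 this
  have hFi : Integrable F := by
    have h1 : Integrable fun w : ℝ => (1 + w ^ 2) ^ (-(1 + δ) / 2) := by
      simpa using integrable_rpow_neg_one_add_norm_sq (E := ℝ) (μ := volume) (r := 1 + δ)
        (by simpa using hδ)
    have h2 := (h1.comp_mul_left' (R := 2 * Real.pi) (by positivity)).const_mul c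
    exact h2.mono' hFc.aestronglyMeasurable (.of_forall hc)
  have hinv := Continuous.fourierInv_fourier_eq (continuous_gammaProfile hδ)
    (integrable_gammaProfile hδ) hFi
  have hp : (2 * Real.pi) ≠ 0 := by positivity
  refine ⟨fun τ => (((2 * Real.pi)⁻¹ : ℝ) : ℂ) * F (-τ * (2 * Real.pi)⁻¹) *
    Complex.exp (Complex.I * ((-τ : ℝ) : ℂ)), by fun_prop, ⟨(2 * Real.pi)⁻¹ * c, by positivity,
    fun τ => ?_⟩, fun r => ?_⟩
  · rw [norm_mul, norm_cexp_I_mul, mul_one, norm_mul, Complex.norm_real,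
      Real.norm_of_nonneg (by positivity), mul_assoc]
    refine mul_le_mul_of_nonneg_left ?_ (by positivity)
    have h1 : 2 * Real.pi * (-τ * (2 * Real.pi)⁻¹) = -τ := by field_simp
    simpa only [h1, neg_sq] using hc (-τ * (2 * Real.pi)⁻¹)
  · have h1 := congrFun hinv (1 - r)
    rw [Real.fourierInv_eq'] at h1
    have h2 := Measure.integral_comp_mul_right (fun w : ℝ =>
      Complex.exp (2 * Real.pi * inner ℝ w (1 - r) * Complex.I) • F w) (-(2 * Real.pi)⁻¹)
    have h3 : ((posRpow (1 - r) δ : ℝ) : ℂ) = (Real.exp (1 - r) : ℂ) * gammaProfile δ (1 - r) := by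
      rw [gammaProfile, ← Complex.ofReal_mul, mul_left_comm, ← Real.exp_add, add_neg_cancel,
        Real.exp_zero, mul_one]
    rw [h3, ← h1]
    congr 1
    rw [inv_neg, inv_inv, abs_neg, abs_of_pos (by positivity)] at h2
    have h4 : ∀ A B : ℂ, A = (2 * Real.pi) • B → B = (((2 * Real.pi)⁻¹ : ℝ) : ℂ) * A := by
      rintro A B rfl
      rw [← Complex.real_smul, smul_smul, inv_mul_cancel₀ hp, one_smul]
    have h5 := h4 _ _ h2
    push_cast at h5 ⊢
    rw [h5, ← integral_const_mul]
    refine integral_congr_ae (.of_forall fun τ => ?_)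
    simp only [smul_eq_mul, mul_neg, neg_mul, mul_assoc]
    congr 1
    rw [mul_comm, ← Complex.exp_add]
    congr 2
    have h6 : (⟪-(τ * (2 * Real.pi)⁻¹), 1 - r⟫ : ℝ) = -(τ * (1 - r)) * (2 * Real.pi)⁻¹ := by
      simp only [RCLike.inner_apply]
      simp
      ring
    have hpc : (Real.pi : ℂ) ≠ 0 := by exact_mod_cast Real.pi_ne_zero
    rw [h6]
    push_cast
    field_simp
    ring

lemma contDiff_comp_norm {E F : Type*} [NormedAddCommGroup E] [InnerProductSpace ℝ E]
    [NormedAddCommGroup F] [NormedSpace ℝ F] {u : ℝ × ℝ → F} {c : ℝ} (hc : 0 < c)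
    (hu : ∀ s r, 0 < r → ContDiffAt ℝ ∞ u (s, r)) (h0 : ∀ s r, |r| < c → u (s, r) = 0) :
    ContDiff ℝ ∞ fun z : ℝ × E => u (z.1, ‖z.2‖) := by
  refine contDiff_iff_contDiffAt.2 fun ⟨s, ξ⟩ => ?_
  by_cases hξ : ξ = 0
  · subst hξ
    refine (contDiffAt_const (c := (0 : F))).congr_of_eventuallyEq ?_
    have : ∀ᶠ z : ℝ × E in nhds (s, 0), ‖z.2‖ < c := by
      have : Filter.Tendsto (fun z : ℝ × E => ‖z.2‖) (nhds (s, 0)) (nhds 0) := by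
        have : Continuous fun z : ℝ × E => ‖z.2‖ := by fun_prop
        simpa using this.tendsto (s, 0)
      exact this.eventually (gt_mem_nhds hc)
    filter_upwards [this] with z hz
    exact h0 _ _ (by simpa using hz)
  · have h1 : ContDiffAt ℝ ∞ (fun z : ℝ × E => (z.1, ‖z.2‖)) (s, ξ) :=
      contDiffAt_fst.prodMk ((contDiffAt_norm ℝ hξ).comp (s, ξ) contDiffAt_snd)
    exact (hu s ‖ξ‖ (norm_pos_iff.2 hξ)).comp (s, ξ) h1

/-- A smooth even cutoff, equal to one on `[-1/4, 1/4]` and supported in `[-1/2, 1/2]`. -/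
def lowCut : ContDiffBump (0 : ℝ) := ⟨1 / 4, 1 / 2, by norm_num, by norm_num⟩

/-- A smooth cutoff to `1/4 ≤ |r| ≤ 4`, complementary to `lowCut` on `[-2, 2]`. -/
def annCut (r : ℝ) : ℝ := lowCut (r / 8) - lowCut r

lemma lowCut_eq_zero {r : ℝ} (h : 1 / 2 ≤ |r|) : lowCut r = 0 :=
  lowCut.zero_of_le_dist (by simpa [lowCut] using h)

lemma lowCut_eq_one {r : ℝ} (h : |r| ≤ 1 / 4) : lowCut r = 1 :=
  lowCut.one_of_mem_closedBall (by simpa [lowCut] using h)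

lemma annCut_eq_zero_of_lt {r : ℝ} (h : |r| < 1 / 4) : annCut r = 0 := by
  have h8 : |r / 8| ≤ 1 / 4 := by rw [abs_div]; norm_num; linarith
  rw [annCut, lowCut_eq_one h.le, lowCut_eq_one h8, sub_self]

lemma annCut_eq_zero_of_gt {r : ℝ} (h : 4 < |r|) : annCut r = 0 := by
  have h8 : 1 / 2 ≤ |r / 8| := by rw [abs_div]; norm_num; linarith
  rw [annCut, lowCut_eq_zero h8, lowCut_eq_zero (r := r) (by linarith), sub_self]

lemma lowCut_add_annCut {r : ℝ} (h : |r| ≤ 2) : lowCut r + annCut r = 1 := by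
  have h8 : |r / 8| ≤ 1 / 4 := by rw [abs_div]; norm_num; linarith
  rw [annCut, lowCut_eq_one h8]
  ring

lemma contDiff_lowCut : ContDiff ℝ ∞ lowCut := lowCut.contDiff

lemma contDiff_annCut : ContDiff ℝ ∞ annCut :=
  (contDiff_lowCut.comp (contDiff_id.div_const 8)).sub contDiff_lowCut

/-- The annular profile `χ₁(r) e^{1 - r}`. -/
def annProf (r : ℝ) : ℂ := ((annCut r * Real.exp (1 - r) : ℝ) : ℂ)

lemma contDiff_annProf : ContDiff ℝ ∞ annProf :=
  Complex.ofRealCLM.contDiff.comp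
    (contDiff_annCut.mul (Real.contDiff_exp.comp (contDiff_const.sub contDiff_id)))

lemma annProf_eq_zero_of_lt {r : ℝ} (h : |r| < 1 / 4) : annProf r = 0 := by
  simp [annProf, annCut_eq_zero_of_lt h]

lemma annProf_eq_zero_of_gt {r : ℝ} (h : 4 < |r|) : annProf r = 0 := by
  simp [annProf, annCut_eq_zero_of_gt h]

/-- The symbol `e^{iτ|ξ|} χ₁(|ξ|) e^{1 - |ξ|}`. -/
def waveSymb {n : ℕ} (τ : ℝ) (ξ : V n) : ℂ :=
  Complex.exp (Complex.I * ((τ * ‖ξ‖ : ℝ) : ℂ)) * annProf ‖ξ‖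

lemma contDiff_waveSymb {n : ℕ} : ContDiff ℝ ∞ fun z : ℝ × V n => waveSymb z.1 z.2 := by
  refine contDiff_comp_norm (u := fun w : ℝ × ℝ =>
    Complex.exp (Complex.I * ((w.1 * w.2 : ℝ) : ℂ)) * annProf w.2) (c := 1 / 4) (by norm_num)
    (fun s r _ => ContDiff.contDiffAt ?_) fun s r h => ?_
  · refine ContDiff.mul ?_ (contDiff_annProf.comp contDiff_snd)
    exact
      (contDiff_const.mul (Complex.ofRealCLM.contDiff.comp (contDiff_fst.mul contDiff_snd))).cexp
  · simp [annProf_eq_zero_of_lt h]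

lemma waveSymb_eq_zero {n : ℕ} (τ : ℝ) (ξ : V n) (h : 4 < ‖ξ‖) : waveSymb τ ξ = 0 := by
  rw [waveSymb, annProf_eq_zero_of_gt (by simpa using h), mul_zero]

/-- The symbol `(s² + |ξ|²)^{a/2} χ₁(|ξ|) e^{1 - |ξ|}`. -/
def besselSymb {n : ℕ} (a s : ℝ) (ξ : V n) : ℂ :=
  (((s ^ 2 + ‖ξ‖ ^ 2) ^ (a / 2) : ℝ) : ℂ) * annProf ‖ξ‖

lemma contDiff_besselSymb {n : ℕ} (a : ℝ) :
    ContDiff ℝ ∞ fun z : ℝ × V n => besselSymb a z.1 z.2 := by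
  refine contDiff_comp_norm (u := fun w : ℝ × ℝ =>
    (((w.1 ^ 2 + w.2 ^ 2) ^ (a / 2) : ℝ) : ℂ) * annProf w.2) (c := 1 / 4) (by norm_num)
    (fun s r hr => ?_) fun s r h => ?_
  · refine ContDiffAt.mul ?_ (contDiff_annProf.comp contDiff_snd).contDiffAt
    refine Complex.ofRealCLM.contDiff.contDiffAt.comp (s, r) ?_
    exact ContDiffAt.rpow_const_of_ne (by fun_prop) (by positivity)
  · simp [annProf_eq_zero_of_lt h]

lemma besselSymb_eq_zero {n : ℕ} (a s : ℝ) (ξ : V n) (h : 4 < ‖ξ‖) : besselSymb a s ξ = 0 := by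
  rw [besselSymb, annProf_eq_zero_of_gt (by simpa using h), mul_zero]

lemma invFT_comp_smul {n : ℕ} {c : ℝ} (hc : 0 < c) (G : V n → ℂ) (x : V n) :
    invFT (fun ξ => G (c⁻¹ • ξ)) x = (c : ℂ) ^ n * invFT G (c • x) := by
  have h := Measure.integral_comp_smul (volume : Measure (V n))
    (fun ξ => Complex.exp (Complex.I * ((⟪c • x, ξ⟫ : ℝ) : ℂ)) * G ξ) c⁻¹
  rw [finrank_euclideanSpace_fin, inv_pow, inv_inv, abs_of_pos (by positivity)] at h
  unfold invFT
  rw [mul_left_comm, ← Complex.ofReal_pow, ← Complex.real_smul (x := c ^ n), ← h]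
  congr 1
  refine integral_congr_ae (.of_forall fun y => ?_)
  simp only [inner_smul_left, inner_smul_right]
  congr 4
  simp
  field_simp

lemma lintegral_comp_smul_eq {n : ℕ} {c : ℝ} (hc : 0 < c) (F : V n → ℝ≥0∞) :
    ∫⁻ x, F (c • x) = ENNReal.ofReal ((c ^ n)⁻¹) * ∫⁻ x, F x := by
  have h := (Homeomorph.smulOfNeZero c hc.ne' : V n ≃ₜ V n).measurableEmbedding.lintegral_map
    F (μ := (volume : Measure (V n)))
  simp only [Homeomorph.smulOfNeZero_apply] at h
  rw [← h]
  have h2 := Measure.map_addHaar_smul (volume : Measure (V n)) hc.ne'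
  rw [finrank_euclideanSpace_fin, abs_of_pos (by positivity)] at h2
  change ∫⁻ x, F x ∂(Measure.map (fun x => c • x) volume) = _
  rw [h2, lintegral_smul_measure, smul_eq_mul]

lemma lintegral_invFT_comp_smul {n : ℕ} {c : ℝ} (hc : 0 < c) (G : V n → ℂ) :
    ∫⁻ x, ‖invFT (fun ξ => G (c⁻¹ • ξ)) x‖ₑ = ∫⁻ x, ‖invFT G x‖ₑ := by
  simp only [invFT_comp_smul hc, enorm_mul]
  rw [lintegral_const_mul' _ _ (by finiteness), lintegral_comp_smul_eq hc fun x => ‖invFT G x‖ₑ,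
    ← mul_assoc]
  have : ‖(c : ℂ) ^ n‖ₑ = ENNReal.ofReal (c ^ n) := by
    rw [← ofReal_norm, norm_pow, Complex.norm_real, Real.norm_of_nonneg hc.le]
  rw [this, ← ENNReal.ofReal_mul (by positivity), mul_inv_cancel₀ (by positivity),
    ENNReal.ofReal_one, one_mul]

/-- The low-frequency profile `χ₀(r) (1 - r)₊^δ`. -/
def lowProf (δ r : ℝ) : ℝ := lowCut r * posRpow (1 - r) δ

lemma contDiff_lowProf (δ : ℝ) : ContDiff ℝ ∞ (lowProf δ) := by
  refine contDiff_iff_contDiffAt.2 fun r => ?_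
  by_cases hr : r < 1
  · have h : ContDiffAt ℝ ∞ (fun r : ℝ => lowCut r * (1 - r) ^ δ) r :=
      contDiff_lowCut.contDiffAt.mul
        (ContDiffAt.rpow_const_of_ne (by fun_prop) (by linarith))
    refine h.congr_of_eventuallyEq ?_
    filter_upwards [gt_mem_nhds hr] with x hx
    rw [lowProf, posRpow, if_pos (by linarith)]
  · refine (contDiffAt_const (c := (0 : ℝ))).congr_of_eventuallyEq ?_
    filter_upwards [lt_mem_nhds (show (1 / 2 : ℝ) < r by linarith)] with x hx
    rw [lowProf, lowCut_eq_zero ((le_abs_self x).trans' hx.le), zero_mul]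

lemma lowProf_eq_zero {δ r : ℝ} (h : 1 / 2 ≤ |r|) : lowProf δ r = 0 := by
  rw [lowProf, lowCut_eq_zero h, zero_mul]

/-- A smooth bump function at the origin, supported in the unit ball. -/
def unitBump (n : ℕ) : ContDiffBump (0 : V n) := ⟨1 / 2, 1, by norm_num, by norm_num⟩

/-- The norm, smoothed out inside the unit ball. -/
def smoothNorm {n : ℕ} (ξ : V n) : ℝ := ‖ξ‖ * (1 - unitBump n ξ)

lemma contDiff_smoothNorm {n : ℕ} : ContDiff ℝ ∞ (smoothNorm (n := n)) := by
  refine contDiff_iff_contDiffAt.2 fun ξ => ?_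
  by_cases hξ : ξ = 0
  · subst hξ
    refine (contDiffAt_const (c := (0 : ℝ))).congr_of_eventuallyEq ?_
    filter_upwards [(unitBump n).eventuallyEq_one] with x hx
    rw [smoothNorm, hx, Pi.one_apply, sub_self, mul_zero]
  · exact (contDiffAt_norm ℝ hξ).mul (contDiffAt_const.sub (unitBump n).contDiff.contDiffAt)

lemma smoothNorm_eq_norm {n : ℕ} {ξ : V n} (h : 1 ≤ ‖ξ‖) : smoothNorm ξ = ‖ξ‖ := by
  rw [smoothNorm, (unitBump n).zero_of_le_dist (by simpa [unitBump] using h), sub_zero, mul_one]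

/-- The derivative of `s ↦ lowProf δ (s · smoothNorm (s⁻¹ ξ))`, at `η = s⁻¹ ξ`. -/
def lowSymb {n : ℕ} (δ s : ℝ) (η : V n) : ℝ :=
  deriv (lowProf δ) (s * smoothNorm η) * (smoothNorm η - fderiv ℝ smoothNorm η η)

lemma contDiff_lowSymb {n : ℕ} (δ : ℝ) : ContDiff ℝ ∞ fun z : ℝ × V n => lowSymb δ z.1 z.2 := by
  have h1 : ContDiff ℝ ∞ (deriv (lowProf δ)) :=
    ((contDiff_infty_iff_deriv).1 (contDiff_lowProf δ)).2
  have h2 : ContDiff ℝ ∞ fun z : ℝ × V n => smoothNorm z.2 := contDiff_smoothNorm.comp contDiff_snd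
  have h3 : ContDiff ℝ ∞ fun η : V n => fderiv ℝ smoothNorm η η :=
    (contDiff_smoothNorm.fderiv_right (m := ∞) (by simp)).clm_apply contDiff_id
  exact (h1.comp (contDiff_fst.mul h2)).mul (h2.sub (h3.comp contDiff_snd))

lemma lowSymb_eq_zero {n : ℕ} (δ s : ℝ) {η : V n} (h : 1 < ‖η‖) : lowSymb δ s η = 0 := by
  have h0 : η ≠ 0 := norm_pos_iff.1 (by linarith)
  have he : smoothNorm =ᶠ[nhds η] fun x => ‖x‖ := by
    filter_upwards [continuous_norm.continuousAt.eventually (lt_mem_nhds h)] with x hx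
    exact smoothNorm_eq_norm hx.le
  have hd : DifferentiableAt ℝ (fun x : V n => ‖x‖) η :=
    (contDiffAt_norm ℝ (n := 1) h0).differentiableAt (by simp)
  rw [lowSymb, he.fderiv_eq, smoothNorm_eq_norm h.le, hd.fderiv_norm_self, sub_self, mul_zero]

lemma hasDerivAt_lowProf_smoothNorm {n : ℕ} (δ : ℝ) (ξ : V n) {s : ℝ} (hs : 0 < s) :
    HasDerivAt (fun s : ℝ => lowProf δ (s * smoothNorm (s⁻¹ • ξ))) (lowSymb δ s (s⁻¹ • ξ)) s := by
  have h1 : HasDerivAt (fun s : ℝ => s⁻¹ • ξ) ((-(s ^ 2)⁻¹) • ξ) s :=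
    (hasDerivAt_inv hs.ne').smul_const ξ
  have h2 := ((contDiff_smoothNorm (n := n)).differentiable (by simp)
    (s⁻¹ • ξ)).hasFDerivAt.comp_hasDerivAt s h1
  have h3 := (hasDerivAt_id' s).mul h2
  have h4 := (((contDiff_lowProf δ).differentiable (by simp))
    (s * smoothNorm (s⁻¹ • ξ))).hasDerivAt.comp s h3
  refine h4.congr_deriv ?_
  rw [lowSymb]
  congr 1
  simp only [one_mul, map_smul, smul_eq_mul, Function.comp]
  field_simp
  ring

lemma continuous_lowSymb_comp {n : ℕ} (δ : ℝ) (ξ : V n) :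
    ContinuousOn (fun s : ℝ => lowSymb δ s (s⁻¹ • ξ)) (Set.Ioi 0) := by
  refine (contDiff_lowSymb δ).continuous.comp_continuousOn (f := fun s : ℝ => (s, s⁻¹ • ξ)) ?_
  exact continuousOn_id.prodMk
    ((continuousOn_inv₀.mono fun s hs => hs.out.ne').smul continuousOn_const)

lemma lowProf_norm_eq {n : ℕ} (δ : ℝ) {ξ : V n} (hξ : ξ ≠ 0) :
    lowProf δ ‖ξ‖ = lowProf δ (smoothNorm ξ) - ∫ s in Set.Ioc (0 : ℝ) 1, lowSymb δ s (s⁻¹ • ξ) := by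
  have hξ0 : 0 < ‖ξ‖ := norm_pos_iff.2 hξ
  set ε := min ‖ξ‖ 1 / 2
  have hε : 0 < ε := by positivity
  have hε1 : ε < 1 := by have := min_le_right ‖ξ‖ 1; simp only [ε]; linarith
  have hε2 : ε < ‖ξ‖ := by have := min_le_left ‖ξ‖ 1; simp only [ε]; linarith
  have hinv {s : ℝ} (hs : 0 < s) (hs2 : s ≤ ε) : 1 < ‖s⁻¹ • ξ‖ := by
    rw [norm_smul, norm_inv, Real.norm_of_nonneg hs.le, inv_mul_eq_div, one_lt_div hs]
    linarith
  have hsub : Set.uIcc ε 1 ⊆ Set.Ioi 0 := by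
    rw [Set.uIcc_of_le hε1.le]
    exact fun s hs => hε.trans_le hs.1
  have h1 : ∫ s in ε..1, lowSymb δ s (s⁻¹ • ξ) = lowProf δ (smoothNorm ξ) - lowProf δ ‖ξ‖ := by
    rw [intervalIntegral.integral_eq_sub_of_hasDerivAt
      (fun s hs => hasDerivAt_lowProf_smoothNorm δ ξ (hsub hs))
      ((continuous_lowSymb_comp δ ξ).mono hsub).intervalIntegrable]
    rw [inv_one, one_smul, one_mul, smoothNorm_eq_norm (hinv hε le_rfl).le, norm_smul, norm_inv,
      Real.norm_of_nonneg hε.le, mul_inv_cancel_left₀ hε.ne']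
  have h2 : Set.Ioc (0 : ℝ) 1 = Set.Ioc 0 ε ∪ Set.Ioc ε 1 :=
    (Set.Ioc_union_Ioc_eq_Ioc hε.le hε1.le).symm
  have h3 : ∀ s ∈ Set.Ioc 0 ε, lowSymb δ s (s⁻¹ • ξ) = 0 := fun s hs =>
    lowSymb_eq_zero δ s (hinv hs.1 hs.2)
  have h4 : IntegrableOn (fun s => lowSymb δ s (s⁻¹ • ξ)) (Set.Ioc 0 ε) :=
    integrableOn_zero.congr_fun (fun s hs => (h3 s hs).symm) measurableSet_Ioc
  have h5 : IntegrableOn (fun s => lowSymb δ s (s⁻¹ • ξ)) (Set.Ioc ε 1) := by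
    have := (((continuous_lowSymb_comp δ ξ).mono hsub).intervalIntegrable (μ := volume)).1
    exact this
  rw [h2, setIntegral_union (Set.Ioc_disjoint_Ioc_of_le le_rfl) measurableSet_Ioc h4 h5,
    setIntegral_congr_fun measurableSet_Ioc h3, ← intervalIntegral.integral_of_le hε1.le, h1]
  simp

lemma measurable_lowSymb_comp {n : ℕ} (δ : ℝ) :
    Measurable fun z : ℝ × V n => lowSymb δ z.1 (z.1⁻¹ • z.2) := by
  have h := (contDiff_lowSymb (n := n) δ).continuous.measurable
  exact h.comp (f := fun z : ℝ × V n => (z.1, z.1⁻¹ • z.2))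
    (measurable_fst.prodMk (measurable_fst.inv.smul measurable_snd))

lemma integrable_lowSymb_comp {n : ℕ} (δ : ℝ) :
    Integrable (fun z : ℝ × V n => lowSymb δ z.1 (z.1⁻¹ • z.2))
      ((volume.restrict (Set.Ioc (0 : ℝ) 1)).prod volume) := by
  obtain ⟨C, hC⟩ := ((isCompact_Icc (a := (0 : ℝ)) (b := 1)).prod
    (isCompact_closedBall (0 : V n) 1)).exists_bound_of_continuousOn
      (contDiff_lowSymb (n := n) δ).continuous.continuousOn
  have hb : Integrable (fun z : ℝ × V n => C * ((Metric.closedBall (0 : V n) 1).indicator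
      (fun _ => (1 : ℝ)) z.2)) ((volume.restrict (Set.Ioc (0 : ℝ) 1)).prod volume) := by
    refine Integrable.mul_prod (f := fun _ : ℝ => C) (integrable_const _) ?_
    rw [integrable_indicator_iff measurableSet_closedBall]
    exact integrableOn_const measure_closedBall_lt_top.ne
  refine hb.mono' (measurable_lowSymb_comp δ).aestronglyMeasurable ?_
  have hae : ∀ᵐ z ∂((volume.restrict (Set.Ioc (0 : ℝ) 1)).prod (volume : Measure (V n))),
      z.1 ∈ Set.Ioc (0 : ℝ) 1 :=
    Measure.quasiMeasurePreserving_fst.ae (ae_restrict_mem measurableSet_Ioc)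
  filter_upwards [hae] with z hz
  have hz1 : ‖z.1⁻¹ • z.2‖ = z.1⁻¹ * ‖z.2‖ := by
    rw [norm_smul, norm_inv, Real.norm_of_nonneg hz.1.le]
  by_cases h : ‖z.1⁻¹ • z.2‖ ≤ 1
  · have h2 : ‖z.2‖ ≤ 1 := by
      rw [hz1, inv_mul_eq_div, div_le_one hz.1] at h
      exact h.trans hz.2
    rw [Set.indicator_of_mem (by simpa using h2), mul_one]
    exact hC (z.1, z.1⁻¹ • z.2) ⟨⟨hz.1.le, hz.2⟩, by simpa using h⟩
  · rw [lowSymb_eq_zero δ _ (not_le.1 h), norm_zero]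
    have hC0 : 0 ≤ C := (norm_nonneg _).trans
      (hC (0, 0) ⟨⟨le_rfl, zero_le_one⟩, by simp⟩)
    exact mul_nonneg hC0 (Set.indicator_nonneg (fun _ _ => zero_le_one) _)

lemma invFT_lowProf_norm {n : ℕ} (hn : 0 < n) (δ : ℝ) (x : V n) :
    invFT (fun ξ => (lowProf δ ‖ξ‖ : ℂ)) x = invFT (fun ξ => (lowProf δ (smoothNorm ξ) : ℂ)) x -
      ∫ s in Set.Ioc (0 : ℝ) 1, invFT (fun ξ => (lowSymb δ s (s⁻¹ • ξ) : ℂ)) x := by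
  have : Nonempty (Fin n) := ⟨⟨0, hn⟩⟩
  have hI : Integrable (Function.uncurry fun (s : ℝ) (ξ : V n) =>
      Complex.exp (Complex.I * ((⟪x, ξ⟫ : ℝ) : ℂ)) * (lowSymb δ s (s⁻¹ • ξ) : ℂ))
      ((volume.restrict (Set.Ioc (0 : ℝ) 1)).prod volume) := by
    have h0 := (integrable_lowSymb_comp (n := n) δ).ofReal (𝕜 := ℂ)
    refine h0.norm.mono' ((Continuous.aestronglyMeasurable (by fun_prop)).mul h0.1)
      (.of_forall fun z => ?_)
    simp only [Function.uncurry, norm_mul, norm_cexp_I_mul, one_mul]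
    exact le_rfl
  have hJ := hI.integral_prod_right
  simp only [Function.uncurry, integral_const_mul] at hJ
  have hK : Integrable fun ξ : V n => Complex.exp (Complex.I * ((⟪x, ξ⟫ : ℝ) : ℂ)) *
      (lowProf δ (smoothNorm ξ) : ℂ) := by
    have h1 : Continuous fun ξ : V n => (lowProf δ (smoothNorm ξ) : ℂ) :=
      Complex.continuous_ofReal.comp
        ((contDiff_lowProf δ).continuous.comp contDiff_smoothNorm.continuous)
    refine Continuous.integrable_of_hasCompactSupport (by fun_prop)
      (hasCompactSupport_of_norm (R := 1) fun ξ hξ => ?_)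
    rw [smoothNorm_eq_norm hξ.le, lowProf_eq_zero (by rw [abs_norm]; linarith)]
    simp
  unfold invFT
  rw [integral_const_mul, ← mul_sub]
  congr 1
  rw [integral_integral_swap hI]
  simp only [integral_const_mul]
  rw [← integral_sub hK hJ]
  refine integral_congr_ae ?_
  filter_upwards [Measure.ae_ne volume (0 : V n)] with ξ hξ
  rw [lowProf_norm_eq δ hξ, integral_complex_ofReal]
  push_cast
  ring

lemma integrable_lowProf_norm {n : ℕ} (δ : ℝ) : Integrable fun ξ : V n => (lowProf δ ‖ξ‖ : ℂ) := by
  have h1 : Continuous fun ξ : V n => (lowProf δ ‖ξ‖ : ℂ) :=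
    Complex.continuous_ofReal.comp ((contDiff_lowProf δ).continuous.comp continuous_norm)
  refine h1.integrable_of_hasCompactSupport (hasCompactSupport_of_norm (R := 1) fun ξ hξ => ?_)
  rw [lowProf_eq_zero (by rw [abs_norm]; linarith), Complex.ofReal_zero]

lemma lintegral_invFT_lowProf_ne_top {n : ℕ} (hn : 0 < n) (δ : ℝ) :
    ∫⁻ x : V n, ‖invFT (fun ξ => (lowProf δ ‖ξ‖ : ℂ)) x‖ₑ ≠ ⊤ := by
  obtain ⟨A, hA, hA'⟩ := exists_lintegral_invFT_family_le
    (M := fun z : ℝ × V n => (lowProf δ (smoothNorm z.2) : ℂ)) (R := 1)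
    (Complex.ofRealCLM.contDiff.comp
      ((contDiff_lowProf δ).comp (contDiff_smoothNorm.comp contDiff_snd))) (fun s ξ hξ => by
        simp only
        rw [smoothNorm_eq_norm hξ.le, lowProf_eq_zero (by rw [abs_norm]; linarith),
          Complex.ofReal_zero])
  obtain ⟨B, hB, hB'⟩ := exists_lintegral_invFT_family_le
    (M := fun z : ℝ × V n => (lowSymb δ z.1 z.2 : ℂ)) (R := 1)
    (Complex.ofRealCLM.contDiff.comp (contDiff_lowSymb δ)) (fun s ξ hξ => by
        simp only
        rw [lowSymb_eq_zero δ s hξ, Complex.ofReal_zero])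
  have hm : Measurable fun z : ℝ × V n =>
      invFT (fun ξ => (lowSymb δ z.1 (z.1⁻¹ • ξ) : ℂ)) z.2 := by
    unfold invFT
    refine Measurable.const_mul ?_ _
    refine (StronglyMeasurable.integral_prod_right' (f := fun w : (ℝ × V n) × V n =>
      Complex.exp (Complex.I * ((⟪w.1.2, w.2⟫ : ℝ) : ℂ)) *
        (lowSymb δ w.1.1 (w.1.1⁻¹ • w.2) : ℂ)) ?_).measurable
    refine Measurable.stronglyMeasurable (Measurable.mul ?_ ?_)
    · exact Continuous.measurable (by fun_prop)
    · exact Complex.measurable_ofReal.comp ((measurable_lowSymb_comp δ).comp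
        ((measurable_fst.comp measurable_fst).prodMk measurable_snd))
  have hm1 : Measurable fun x : V n => invFT (fun ξ => (lowProf δ (smoothNorm ξ) : ℂ)) x := by
    refine (continuous_invFT ?_).measurable
    have h1 : Continuous fun ξ : V n => (lowProf δ (smoothNorm ξ) : ℂ) :=
      Complex.continuous_ofReal.comp
        ((contDiff_lowProf δ).continuous.comp contDiff_smoothNorm.continuous)
    refine h1.integrable_of_hasCompactSupport
      (hasCompactSupport_of_norm (R := 1) fun ξ hξ => ?_)
    rw [smoothNorm_eq_norm hξ.le, lowProf_eq_zero (by rw [abs_norm]; linarith),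
      Complex.ofReal_zero]
  refine ne_top_of_le_ne_top (ENNReal.add_ne_top.2 ⟨hA, hB⟩) ?_
  calc ∫⁻ x : V n, ‖invFT (fun ξ => (lowProf δ ‖ξ‖ : ℂ)) x‖ₑ
      ≤ ∫⁻ x : V n, (‖invFT (fun ξ => (lowProf δ (smoothNorm ξ) : ℂ)) x‖ₑ +
        ∫⁻ s in Set.Ioc (0 : ℝ) 1, ‖invFT (fun ξ => (lowSymb δ s (s⁻¹ • ξ) : ℂ)) x‖ₑ) := by
        refine lintegral_mono fun x => ?_
        rw [invFT_lowProf_norm hn]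
        refine (enorm_sub_le).trans ?_
        gcongr
        exact enorm_integral_le_lintegral_enorm _
    _ = (∫⁻ x : V n, ‖invFT (fun ξ => (lowProf δ (smoothNorm ξ) : ℂ)) x‖ₑ) +
        ∫⁻ s in Set.Ioc (0 : ℝ) 1, ∫⁻ x : V n,
          ‖invFT (fun ξ => (lowSymb δ s (s⁻¹ • ξ) : ℂ)) x‖ₑ := by
        rw [lintegral_add_left hm1.enorm, lintegral_lintegral_swap]
        exact (hm.enorm.comp measurable_swap).aemeasurable
    _ ≤ A + ∫⁻ s in Set.Ioc (0 : ℝ) 1, B := by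
        refine add_le_add (hA' 0 (by simp)) ?_
        refine setLIntegral_mono measurable_const fun s hs => ?_
        rw [lintegral_invFT_comp_smul hs.1 fun ξ => (lowSymb δ s ξ : ℂ)]
        exact hB' s ⟨by linarith [hs.1], hs.2⟩
    _ = A + B := by simp

lemma exists_lpMass_mult_low_le {n : ℕ} (hn : 0 < n) {p : ℝ} (hp : 1 < p) (δ : ℝ) :
    ∃ A : ℝ≥0∞, A ≠ ⊤ ∧ ∀ f : 𝓢(V n, ℂ),
      lpMass p (mult (fun ξ => (lowProf δ ‖ξ‖ : ℂ)) f) ≤ A * lpMass p f :=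
  ⟨_, ENNReal.rpow_ne_top_of_nonneg (by linarith) (lintegral_invFT_lowProf_ne_top hn δ),
    fun f => lpMass_mult_le hp (integrable_lowProf_norm δ) f⟩

lemma lpMass_const_mul_comp_smul {n : ℕ} {p : ℝ} (hp : 0 < p) {c : ℝ} (hc : 0 < c) (k : ℂ)
    (G : V n → ℂ) : lpMass p (fun x => k * G (c • x)) =
      ‖k‖ₑ ^ p * (ENNReal.ofReal ((c ^ n)⁻¹) * lpMass p G) := by
  unfold lpMass
  simp only [enorm_mul, ENNReal.mul_rpow_of_nonneg _ _ hp.le]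
  rw [lintegral_const_mul' _ _ (by finiteness), lintegral_comp_smul_eq hc fun x => ‖G x‖ₑ ^ p]

lemma contDiff_cexp_mul_besselSymb {n : ℕ} (τ a s : ℝ) : ContDiff ℝ ∞ fun ξ : V n =>
    Complex.exp (Complex.I * ((τ * ‖ξ‖ : ℝ) : ℂ)) * besselSymb a s ξ := by
  have hb : ContDiff ℝ ∞ fun ξ : V n => besselSymb a s ξ :=
    ContDiff.comp (g := fun z : ℝ × V n => besselSymb a z.1 z.2) (f := fun ξ => (s, ξ))
      (contDiff_besselSymb a) (contDiff_const.prodMk contDiff_id)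
  refine contDiff_iff_contDiffAt.2 fun ξ => ?_
  by_cases hξ : ξ = 0
  · subst hξ
    refine (contDiffAt_const (c := (0 : ℂ))).congr_of_eventuallyEq ?_
    filter_upwards [Metric.ball_mem_nhds (0 : V n) (show (0 : ℝ) < 1 / 4 by norm_num)] with x hx
    rw [besselSymb, annProf_eq_zero_of_lt (by simpa using hx), mul_zero, mul_zero]
  · refine ContDiffAt.mul (ContDiffAt.cexp (contDiffAt_const.mul ?_)) hb.contDiffAt
    exact Complex.ofRealCLM.contDiff.contDiffAt.comp ξ (contDiffAt_const.mul (contDiffAt_norm ℝ hξ))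

/-- Frequency localised pieces of `f` at time `τ`, on the Fourier side. -/
lemma exists_schwartz_eq_wave {n : ℕ} (τ a s : ℝ) (f : 𝓢(V n, ℂ)) :
    ∃ P : 𝓢(V n, ℂ), ∀ ξ, P ξ =
      Complex.exp (Complex.I * ((τ * ‖ξ‖ : ℝ) : ℂ)) * besselSymb a s ξ * FT f ξ := by
  have h1 : ContDiff ℝ ∞ fun ξ => Complex.exp (Complex.I * ((τ * ‖ξ‖ : ℝ) : ℂ)) *
      besselSymb a s ξ * FT f ξ := (contDiff_cexp_mul_besselSymb τ a s).mul (contDiff_FT f)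
  have h2 : HasCompactSupport fun ξ => Complex.exp (Complex.I * ((τ * ‖ξ‖ : ℝ) : ℂ)) *
      besselSymb a s ξ * FT f ξ := hasCompactSupport_of_norm (R := 4) fun ξ hξ => by
    rw [besselSymb_eq_zero a s ξ hξ, mul_zero, zero_mul]
  exact ⟨h2.toSchwartzMap h1, fun ξ => rfl⟩

lemma halfWave_eq_invFT {n : ℕ} (t : ℝ) (g : V n → ℂ) :
    halfWave t g = invFT fun ξ => Complex.exp (Complex.I * ((t * ‖ξ‖ : ℝ) : ℂ)) * FT g ξ := by
  ext x
  unfold halfWave invFT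
  congr 1
  refine integral_congr_ae (.of_forall fun ξ => ?_)
  simp only [Complex.ofReal_add, mul_add, Complex.exp_add, mul_assoc]

lemma besselD_eq_invFT {n : ℕ} (s : ℝ) (g : V n → ℂ) :
    besselD s g = invFT fun ξ => (((1 + ‖ξ‖ ^ 2) ^ (s / 2) : ℝ) : ℂ) * FT g ξ := by
  ext x
  unfold besselD invFT
  simp only [mul_assoc]

lemma one_add_norm_sq_rpow {n : ℕ} {l : ℝ} (hl : 0 < l) (a : ℝ) (ξ : V n) :
    (1 + ‖ξ‖ ^ 2) ^ (-a / 2) * (l⁻¹ ^ 2 + ‖l⁻¹ • ξ‖ ^ 2) ^ (a / 2) = l ^ (-a) := by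
  have h : 1 + ‖ξ‖ ^ 2 = l ^ 2 * (l⁻¹ ^ 2 + ‖l⁻¹ • ξ‖ ^ 2) := by
    rw [norm_smul, norm_inv, Real.norm_of_nonneg hl.le]
    field_simp
  rw [h, Real.mul_rpow (by positivity) (by positivity), mul_assoc, ← Real.rpow_add (by positivity),
    neg_div, neg_add_cancel, Real.rpow_zero, mul_one, ← Real.rpow_natCast, ← Real.rpow_mul hl.le]
  congr 1
  push_cast
  ring

lemma exists_schwartz_scaled {n : ℕ} {l : ℝ} (hl : 0 < l) (a : ℝ) (f : 𝓢(V n, ℂ)) :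
    ∃ g : 𝓢(V n, ℂ), (∀ x, g x = (l : ℂ) ^ n * mult (besselSymb a l⁻¹) f (l • x)) ∧
      ∀ t x, besselD (-a) (halfWave t g) x =
        ((l ^ (-a) : ℝ) : ℂ) * (l : ℂ) ^ n * mult (waveSymb (l * t)) f (l • x) := by
  have hl' : l⁻¹ ≠ 0 := inv_ne_zero hl.ne'
  obtain ⟨Q, hQ⟩ := exists_schwartz_eq_wave 0 a l⁻¹ f
  simp only [zero_mul, Complex.ofReal_zero, mul_zero, Complex.exp_zero, one_mul] at hQ
  refine ⟨invFTS (dilS l⁻¹ hl' Q), fun x => ?_, fun t x => ?_⟩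
  · rw [invFTS_apply]
    change invFT (fun ξ => Q (l⁻¹ • ξ)) x = _
    rw [invFT_comp_smul hl, funext hQ]
    rfl
  · obtain ⟨P, hP⟩ := exists_schwartz_eq_wave (l * t) a l⁻¹ f
    have h1 : halfWave t (invFTS (dilS l⁻¹ hl' Q)) = invFTS (dilS l⁻¹ hl' P) := by
      ext y
      rw [halfWave_eq_invFT, invFTS_apply]
      congr 1
      ext ξ
      rw [FT_invFTS, dilS_apply, dilS_apply, hQ, hP, norm_smul, norm_inv,
        Real.norm_of_nonneg hl.le, mul_assoc]
      congr 4
      field_simp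
    have h2 : (fun ξ => (((1 + ‖ξ‖ ^ 2) ^ (-a / 2) : ℝ) : ℂ) *
        FT (invFTS (dilS l⁻¹ hl' P)) ξ) = fun ξ =>
        (fun η => ((l ^ (-a) : ℝ) : ℂ) * (waveSymb (l * t) η * FT f η)) (l⁻¹ • ξ) := by
      ext ξ
      simp only [FT_invFTS, dilS_apply, hP, waveSymb, besselSymb, ← one_add_norm_sq_rpow hl a ξ]
      push_cast
      ring
    rw [h1, besselD_eq_invFT, h2, invFT_comp_smul hl fun η =>
      ((l ^ (-a) : ℝ) : ℂ) * (waveSymb (l * t) η * FT f η)]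
    unfold mult invFT
    simp only [mul_left_comm _ ((l ^ (-a) : ℝ) : ℂ), integral_const_mul]
    ring

lemma lintegral_Icc_eq_mul {l : ℝ} (hl : 0 < l) (F : ℝ → ℝ≥0∞) :
    ∫⁻ τ in Set.Icc l (2 * l), F τ = ENNReal.ofReal l * ∫⁻ t in Set.Icc (1 : ℝ) 2, F (l * t) := by
  have h := lintegral_image_eq_lintegral_abs_deriv_mul (s := Set.Icc (1 : ℝ) 2) measurableSet_Icc
    (f := fun t => l * t) (f' := fun _ => l)
    (fun t _ => by simpa using ((hasDerivAt_id t).const_mul l).hasDerivWithinAt)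
    (fun x _ y _ hxy => mul_left_cancel₀ hl.ne' hxy) F
  have himg : (fun t => l * t) '' Set.Icc (1 : ℝ) 2 = Set.Icc l (2 * l) := by
    rw [Set.image_mul_left_Icc' hl, mul_one, mul_comm l 2]
  rw [himg] at h
  rw [h, abs_of_pos hl, lintegral_const_mul' _ _ (by finiteness)]

lemma exists_lintegral_wave_le {n : ℕ} {p a : ℝ} (hp : 1 < p) {C₀ : ℝ≥0∞} (hC₀ : C₀ ≠ ⊤)
    (hL : ∀ g : 𝓢(V n, ℂ), ∫⁻ t in Set.Icc (1 : ℝ) 2, lpMass p (besselD (-a) (halfWave t g)) ≤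
      C₀ * lpMass p g) :
    ∃ B : ℝ≥0∞, B ≠ ⊤ ∧ ∀ l : ℝ, 1 ≤ l → ∀ f : 𝓢(V n, ℂ),
      ∫⁻ τ in Set.Icc l (2 * l), lpMass p (mult (waveSymb τ) f) ≤
        ENNReal.ofReal (l ^ (1 + a * p)) * (B * lpMass p f) := by
  obtain ⟨A, hA, hA'⟩ := exists_lpMass_mult_family_le (n := n) hp (contDiff_besselSymb a)
    (fun s x => besselSymb_eq_zero a s x)
  have hp0 : 0 < p := by linarith
  refine ⟨C₀ * A, ENNReal.mul_ne_top hC₀ hA, fun l hl f => ?_⟩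
  have hl0 : 0 < l := by linarith
  obtain ⟨g, hg, hg'⟩ := exists_schwartz_scaled hl0 a f
  have h1 := hL g
  simp only [funext (hg' _)] at h1
  rw [funext hg] at h1
  simp only [lpMass_const_mul_comp_smul hp0 hl0, enorm_mul,
    ENNReal.mul_rpow_of_nonneg _ _ hp0.le] at h1
  set K : ℝ≥0∞ := ‖(l : ℂ) ^ n‖ₑ ^ p * ENNReal.ofReal ((l ^ n)⁻¹) with hK
  have hK0 : K ≠ 0 := by
    have : (l : ℂ) ^ n ≠ 0 := pow_ne_zero _ (by exact_mod_cast hl0.ne')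
    refine mul_ne_zero ?_ (by simpa using pow_pos hl0 n)
    exact (ENNReal.rpow_pos (enorm_pos.2 this) (by finiteness)).ne'
  have hKt : K ≠ ⊤ := by finiteness
  set D : ℝ≥0∞ := ‖((l ^ (-a) : ℝ) : ℂ)‖ₑ ^ p with hD
  have h2 : D * ∫⁻ t in Set.Icc (1 : ℝ) 2, lpMass p (mult (waveSymb (l * t)) f) ≤
      C₀ * (A * lpMass p f) := by
    refine (ENNReal.mul_le_mul_iff_right hK0 hKt).1 ?_
    calc _ = ∫⁻ t in Set.Icc (1 : ℝ) 2, D * ‖(l : ℂ) ^ n‖ₑ ^ p *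
          (ENNReal.ofReal ((l ^ n)⁻¹) * lpMass p (mult (waveSymb (l * t)) f)) := by
          rw [← mul_assoc, ← lintegral_const_mul' _ _ (by finiteness)]
          refine lintegral_congr fun t => ?_
          rw [hK]; ring
      _ ≤ _ := h1
      _ ≤ C₀ * (‖(l : ℂ) ^ n‖ₑ ^ p * (ENNReal.ofReal ((l ^ n)⁻¹) * (A * lpMass p f))) := by
          gcongr
          exact hA' l⁻¹ ⟨by linarith [inv_pos.2 hl0], inv_le_one_of_one_le₀ hl⟩ f
      _ = _ := by rw [hK]; ring
  have hDE : ENNReal.ofReal (l ^ (a * p)) * D = 1 := by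
    rw [hD, ← ofReal_norm, Complex.norm_real, Real.norm_of_nonneg (by positivity),
      ENNReal.ofReal_rpow_of_nonneg (by positivity) hp0.le, ← ENNReal.ofReal_mul (by positivity),
      ← Real.rpow_mul hl0.le, ← Real.rpow_add hl0]
    simp
  rw [lintegral_Icc_eq_mul hl0]
  calc _ = ENNReal.ofReal l * (ENNReal.ofReal (l ^ (a * p)) * D *
        ∫⁻ t in Set.Icc (1 : ℝ) 2, lpMass p (mult (waveSymb (l * t)) f)) := by rw [hDE, one_mul]
    _ ≤ ENNReal.ofReal l * (ENNReal.ofReal (l ^ (a * p)) * (C₀ * (A * lpMass p f))) := by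
        rw [mul_assoc (ENNReal.ofReal (l ^ (a * p)))]
        gcongr
    _ = _ := by
        rw [Real.rpow_add hl0, Real.rpow_one, ENNReal.ofReal_mul hl0.le]
        ring

lemma Ici_zero_subset_dyadic :
    Set.Ici (0 : ℝ) ⊆ Set.Icc 0 1 ∪ ⋃ k : ℕ, Set.Icc ((2 : ℝ) ^ k) (2 * 2 ^ k) := by
  intro x hx
  by_cases h : x ≤ 1
  · exact .inl ⟨hx, h⟩
  · obtain ⟨k, hk1, hk2⟩ := exists_nat_pow_near (not_le.1 h).le one_lt_two
    exact .inr (Set.mem_iUnion.2 ⟨k, hk1, by rw [← pow_succ']; exact hk2.le⟩)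

lemma exists_lintegral_Ici_weight_le {b κ : ℝ} (hb : 0 ≤ b) (hκ : 0 < κ) :
    ∃ C : ℝ≥0∞, C ≠ ⊤ ∧ ∀ (F : ℝ → ℝ≥0∞) (B : ℝ≥0∞), (∀ τ ∈ Set.Icc (0 : ℝ) 1, F τ ≤ B) →
      (∀ l : ℝ, 1 ≤ l → ∫⁻ τ in Set.Icc l (2 * l), F τ ≤ ENNReal.ofReal (l ^ b) * B) →
      ∫⁻ τ in Set.Ici (0 : ℝ), ENNReal.ofReal ((1 + τ ^ 2) ^ (-(b + κ) / 2)) * F τ ≤ C * B := by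
  set r : ℝ≥0∞ := ENNReal.ofReal (2 ^ (-κ)) with hr
  have hr1 : r < 1 := by
    rw [hr, ENNReal.ofReal_lt_one]
    exact Real.rpow_lt_one_of_one_lt_of_neg one_lt_two (by linarith)
  have hw1 (τ : ℝ) : ENNReal.ofReal ((1 + τ ^ 2) ^ (-(b + κ) / 2)) ≤ 1 := by
    rw [ENNReal.ofReal_le_one]
    exact Real.rpow_le_one_of_one_le_of_nonpos (by nlinarith [sq_nonneg τ]) (by linarith)
  refine ⟨1 + (1 - r)⁻¹, ENNReal.add_ne_top.2 ⟨ENNReal.one_ne_top,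
    ENNReal.inv_ne_top.2 (tsub_pos_of_lt hr1).ne'⟩, fun F B h1 h2 => ?_⟩
  refine (lintegral_mono_set Ici_zero_subset_dyadic).trans ((lintegral_union_le _ _ _).trans ?_)
  rw [add_mul, one_mul]
  refine add_le_add ?_ ((lintegral_iUnion_le _ _).trans ?_)
  · calc _ ≤ ∫⁻ τ in Set.Icc (0 : ℝ) 1, B := by
          refine setLIntegral_mono measurable_const fun τ hτ => ?_
          exact (mul_le_mul' (hw1 τ) (h1 τ hτ)).trans_eq (one_mul B)
      _ = B := by simp
  · rw [← ENNReal.tsum_geometric, ← ENNReal.tsum_mul_right]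
    refine ENNReal.tsum_le_tsum fun k => ?_
    have hl : (1 : ℝ) ≤ 2 ^ k := one_le_pow₀ one_le_two
    have hl0 : (0 : ℝ) < 2 ^ k := by positivity
    have hw2 (τ : ℝ) (hτ : (2 : ℝ) ^ k ≤ τ) : ENNReal.ofReal ((1 + τ ^ 2) ^ (-(b + κ) / 2)) ≤
        ENNReal.ofReal (((2 : ℝ) ^ k) ^ (-(b + κ))) := by
      refine ENNReal.ofReal_le_ofReal ?_
      have h3 : ((2 : ℝ) ^ k) ^ (-(b + κ)) = (((2 : ℝ) ^ k) ^ 2) ^ (-(b + κ) / 2) := by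
        rw [← Real.rpow_natCast ((2 : ℝ) ^ k) 2, ← Real.rpow_mul hl0.le]
        congr 1
        push_cast
        ring
      rw [h3]
      exact Real.rpow_le_rpow_of_nonpos (by positivity) (by nlinarith) (by linarith)
    calc _ ≤ ∫⁻ τ in Set.Icc ((2 : ℝ) ^ k) (2 * 2 ^ k),
          ENNReal.ofReal (((2 : ℝ) ^ k) ^ (-(b + κ))) * F τ :=
          setLIntegral_mono' measurableSet_Icc fun τ hτ => mul_le_mul_left (hw2 τ hτ.1) _
      _ ≤ ENNReal.ofReal (((2 : ℝ) ^ k) ^ (-(b + κ))) *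
          (ENNReal.ofReal (((2 : ℝ) ^ k) ^ b) * B) := by
          rw [lintegral_const_mul' _ _ (by finiteness)]
          gcongr
          exact h2 _ hl
      _ = r ^ k * B := by
          rw [← mul_assoc, ← ENNReal.ofReal_mul (by positivity), ← Real.rpow_add hl0, hr,
            ← ENNReal.ofReal_pow (by positivity), ← Real.rpow_natCast, ← Real.rpow_natCast,
            ← Real.rpow_mul zero_le_two, ← Real.rpow_mul zero_le_two]
          congr 3
          ring

lemma exists_lintegral_weight_le {b κ : ℝ} (hb : 0 ≤ b) (hκ : 0 < κ) :
    ∃ C : ℝ≥0∞, C ≠ ⊤ ∧ ∀ (F : ℝ → ℝ≥0∞) (B : ℝ≥0∞), (∀ τ ∈ Set.Icc (-1 : ℝ) 1, F τ ≤ B) →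
      (∀ l : ℝ, 1 ≤ l → ∫⁻ τ in Set.Icc l (2 * l), F τ ≤ ENNReal.ofReal (l ^ b) * B) →
      (∀ l : ℝ, 1 ≤ l → ∫⁻ τ in Set.Icc l (2 * l), F (-τ) ≤ ENNReal.ofReal (l ^ b) * B) →
      ∫⁻ τ : ℝ, ENNReal.ofReal ((1 + τ ^ 2) ^ (-(b + κ) / 2)) * F τ ≤ C * B := by
  obtain ⟨C, hC, h⟩ := exists_lintegral_Ici_weight_le hb hκ
  refine ⟨C + C, ENNReal.add_ne_top.2 ⟨hC, hC⟩, fun F B h1 h2 h3 => ?_⟩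
  rw [← setLIntegral_univ, ← Set.Iic_union_Ici (a := (0 : ℝ)), add_mul]
  refine (lintegral_union_le _ _ _).trans (add_le_add ?_ ?_)
  · have h4 := (Measure.measurePreserving_neg (volume : Measure ℝ)).setLIntegral_comp_preimage_emb
      (MeasurableEquiv.neg ℝ).measurableEmbedding
      (fun τ => ENNReal.ofReal ((1 + τ ^ 2) ^ (-(b + κ) / 2)) * F τ) (Set.Iic 0)
    have h5 : Neg.neg ⁻¹' Set.Iic (0 : ℝ) = Set.Ici 0 := by ext; simp
    rw [h5] at h4
    rw [← h4]
    simp only [neg_sq]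
    exact h (fun τ => F (-τ)) B (fun τ hτ => h1 _ ⟨by linarith [hτ.2], by linarith [hτ.1]⟩) h3
  · exact h F B (fun τ hτ => h1 τ ⟨by linarith [hτ.1], hτ.2⟩) h2

/-- Complex conjugation on Schwartz space. -/
def conjS {n : ℕ} (f : 𝓢(V n, ℂ)) : 𝓢(V n, ℂ) :=
  SchwartzMap.postcompCLM (𝕜 := ℝ) (Complex.conjCLE : ℂ →L[ℝ] ℂ) f

lemma conjS_apply {n : ℕ} (f : 𝓢(V n, ℂ)) (x : V n) :
    conjS f x = starRingEnd ℂ (f x) := rfl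

lemma lpMass_conjS {n : ℕ} (p : ℝ) (f : 𝓢(V n, ℂ)) : lpMass p (conjS f) = lpMass p f := by
  unfold lpMass
  refine lintegral_congr fun x => ?_
  rw [conjS_apply, ← ofReal_norm, ← ofReal_norm, RCLike.norm_conj]

lemma conj_cexp_I_mul (x : ℝ) : starRingEnd ℂ (Complex.exp (Complex.I * (x : ℂ))) =
    Complex.exp (-(Complex.I * (x : ℂ))) := by
  rw [← Complex.exp_conj, map_mul, Complex.conj_I, Complex.conj_ofReal, neg_mul]

lemma FT_conjS {n : ℕ} (f : 𝓢(V n, ℂ)) (ξ : V n) :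
    FT (conjS f) ξ = starRingEnd ℂ (FT f (-ξ)) := by
  unfold FT
  rw [← integral_conj]
  refine integral_congr_ae (.of_forall fun y => ?_)
  simp only [map_mul, conjS_apply, inner_neg_right, Complex.ofReal_neg, mul_neg, neg_neg,
    conj_cexp_I_mul]

lemma mult_waveSymb_conjS {n : ℕ} (τ : ℝ) (f : 𝓢(V n, ℂ)) (x : V n) :
    mult (waveSymb τ) (conjS f) x = starRingEnd ℂ (mult (waveSymb (-τ)) f x) := by
  unfold mult invFT
  rw [map_mul, Complex.conj_ofReal, ← integral_conj, ← integral_neg_eq_self]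
  congr 1
  refine integral_congr_ae (.of_forall fun ξ => ?_)
  simp only [FT_conjS, neg_neg, map_mul, waveSymb, norm_neg, inner_neg_right, conj_cexp_I_mul,
    annProf, Complex.conj_ofReal]
  push_cast
  simp only [neg_mul, mul_neg, neg_neg]

lemma lpMass_mult_waveSymb_neg {n : ℕ} (p τ : ℝ) (f : 𝓢(V n, ℂ)) :
    lpMass p (mult (waveSymb (-τ)) f) = lpMass p (mult (waveSymb τ) (conjS f)) := by
  unfold lpMass
  refine lintegral_congr fun x => ?_
  rw [mult_waveSymb_conjS, ← ofReal_norm, ← ofReal_norm, RCLike.norm_conj]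

lemma exists_lintegral_weight_wave_le {n : ℕ} {p a κ : ℝ} (hp : 1 < p) (ha : 0 ≤ a) (hκ : 0 < κ)
    {C₀ : ℝ≥0∞} (hC₀ : C₀ ≠ ⊤)
    (hL : ∀ g : 𝓢(V n, ℂ), ∫⁻ t in Set.Icc (1 : ℝ) 2, lpMass p (besselD (-a) (halfWave t g)) ≤
      C₀ * lpMass p g) :
    ∃ C : ℝ≥0∞, C ≠ ⊤ ∧ ∀ f : 𝓢(V n, ℂ),
      ∫⁻ τ : ℝ, ENNReal.ofReal ((1 + τ ^ 2) ^ (-(1 + a * p + κ) / 2)) *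
        lpMass p (mult (waveSymb τ) f) ≤ C * lpMass p f := by
  obtain ⟨A, hA, hA'⟩ := exists_lpMass_mult_family_le (n := n) hp contDiff_waveSymb
    (fun s x => waveSymb_eq_zero s x)
  obtain ⟨B, hB, hB'⟩ := exists_lintegral_wave_le hp hC₀ hL
  obtain ⟨C, hC, hC'⟩ := exists_lintegral_weight_le
    (b := 1 + a * p) (by positivity) hκ
  refine ⟨C * (A + B), ENNReal.mul_ne_top hC (ENNReal.add_ne_top.2 ⟨hA, hB⟩), fun f => ?_⟩
  rw [mul_assoc]
  refine hC' _ ((A + B) * lpMass p f) (fun τ hτ => (hA' τ hτ f).trans ?_) (fun l hl =>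
    (hB' l hl f).trans ?_) (fun l hl => ?_)
  · gcongr; exact le_self_add
  · gcongr; exact le_add_self
  · simp only [lpMass_mult_waveSymb_neg]
    refine (hB' l hl (conjS f)).trans ?_
    rw [lpMass_conjS]
    gcongr; exact le_add_self

lemma continuous_waveSymb {n : ℕ} : Continuous fun z : ℝ × V n => waveSymb z.1 z.2 :=
  contDiff_waveSymb.continuous

lemma integrable_japanese {κ : ℝ} (hκ : 0 < κ) :
    Integrable fun τ : ℝ => (1 + τ ^ 2) ^ (-(1 + κ) / 2) := by
  simpa using integrable_rpow_neg_one_add_norm_sq (E := ℝ) (μ := volume) (r := 1 + κ)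
    (by simpa using hκ)

lemma measurable_mult_waveSymb {n : ℕ} (f : 𝓢(V n, ℂ)) :
    Measurable fun z : ℝ × V n => mult (waveSymb z.1) f z.2 := by
  unfold mult invFT
  refine Measurable.const_mul ?_ _
  refine (StronglyMeasurable.integral_prod_right' (f := fun w : (ℝ × V n) × V n =>
    Complex.exp (Complex.I * ((⟪w.1.2, w.2⟫ : ℝ) : ℂ)) *
      (waveSymb w.1.1 w.2 * FT f w.2)) ?_).measurable
  refine (Continuous.measurable ?_).stronglyMeasurable
  have h1 : Continuous fun w : (ℝ × V n) × V n => waveSymb w.1.1 w.2 :=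
    continuous_waveSymb.comp (f := fun w : (ℝ × V n) × V n => (w.1.1, w.2)) (by fun_prop)
  have h2 : Continuous fun w : (ℝ × V n) × V n => FT f w.2 :=
    (continuous_FT f).comp continuous_snd
  fun_prop

/-- The high-frequency part of the Bochner–Riesz symbol. -/
def annSymb {n : ℕ} (δ : ℝ) (ξ : V n) : ℂ := ((annCut ‖ξ‖ * posRpow (1 - ‖ξ‖) δ : ℝ) : ℂ)

lemma annSymb_eq {n : ℕ} {δ : ℝ} {h : ℝ → ℂ} (hh : ∀ r : ℝ, ((posRpow (1 - r) δ : ℝ) : ℂ) =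
      (Real.exp (1 - r) : ℂ) * ∫ τ, h τ * Complex.exp (Complex.I * ((τ * r : ℝ) : ℂ))) (ξ : V n) :
    annSymb δ ξ = ∫ τ, h τ * waveSymb τ ξ := by
  simp only [annSymb, waveSymb, ← mul_assoc, integral_mul_const]
  rw [Complex.ofReal_mul, hh, annProf]
  push_cast
  ring

lemma mult_annSymb_eq {n : ℕ} {δ : ℝ} {h : ℝ → ℂ} (hi : Integrable h)
    (hh : ∀ r : ℝ, ((posRpow (1 - r) δ : ℝ) : ℂ) =
      (Real.exp (1 - r) : ℂ) * ∫ τ, h τ * Complex.exp (Complex.I * ((τ * r : ℝ) : ℂ)))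
    (f : 𝓢(V n, ℂ)) (x : V n) :
    mult (annSymb δ) f x = ∫ τ, h τ * mult (waveSymb τ) f x := by
  have h1 : Integrable fun ξ : V n => annProf ‖ξ‖ * FT f ξ := by
    have h2 : Continuous fun ξ : V n => annProf ‖ξ‖ * FT f ξ :=
      (contDiff_annProf.continuous.comp continuous_norm).mul (continuous_FT f)
    refine h2.integrable_of_hasCompactSupport (hasCompactSupport_of_norm (R := 4) fun ξ hξ => ?_)
    rw [annProf_eq_zero_of_gt (by simpa using hξ), zero_mul]
  have hI : Integrable (Function.uncurry fun (ξ : V n) (τ : ℝ) =>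
      Complex.exp (Complex.I * ((⟪x, ξ⟫ : ℝ) : ℂ)) *
        Complex.exp (Complex.I * ((τ * ‖ξ‖ : ℝ) : ℂ)) * (annProf ‖ξ‖ * FT f ξ * h τ))
      (volume.prod volume) := by
    have h0 := h1.mul_prod hi (μ := volume) (ν := volume)
    refine h0.norm.mono' ((Continuous.aestronglyMeasurable (by fun_prop)).mul h0.1)
      (.of_forall fun z => ?_)
    simp only [Function.uncurry, norm_mul, norm_cexp_I_mul, one_mul, le_refl]
  unfold mult invFT
  simp only [mul_left_comm (h _), integral_const_mul]
  congr 1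
  calc _ = ∫ ξ : V n, ∫ τ : ℝ, Complex.exp (Complex.I * ((⟪x, ξ⟫ : ℝ) : ℂ)) *
        Complex.exp (Complex.I * ((τ * ‖ξ‖ : ℝ) : ℂ)) * (annProf ‖ξ‖ * FT f ξ * h τ) := by
        refine integral_congr_ae (.of_forall fun ξ => ?_)
        beta_reduce
        rw [annSymb_eq hh, ← integral_mul_const, ← integral_const_mul]
        refine integral_congr_ae (.of_forall fun τ => ?_)
        simp only [waveSymb]
        ring
    _ = _ := by
        rw [integral_integral_swap hI]
        refine integral_congr_ae (.of_forall fun τ => ?_)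
        beta_reduce
        rw [← integral_const_mul]
        refine integral_congr_ae (.of_forall fun ξ => ?_)
        simp only [waveSymb]
        ring

lemma lpMass_le_of_enorm_le_lintegral {n : ℕ} {p : ℝ} (hp : 1 < p) {k d : ℝ → ℝ≥0∞}
    (hk : Measurable k) (hkt : ∫⁻ τ, k τ ≠ ⊤) (hd : Measurable d) {W : ℝ × V n → ℂ}
    (hW : Measurable W) {g : V n → ℂ} (hg : ∀ x, ‖g x‖ₑ ≤ ∫⁻ τ, k τ * (d τ * ‖W (τ, x)‖ₑ)) :
    lpMass p g ≤
      (∫⁻ τ, k τ) ^ (p - 1) * ∫⁻ τ, k τ * d τ ^ p * lpMass p fun x => W (τ, x) := by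
  have hp0 : 0 ≤ p := by linarith
  have hWx (x : V n) : Measurable fun τ : ℝ => W (τ, x) :=
    hW.comp (measurable_id.prodMk measurable_const)
  have hm : Measurable fun z : V n × ℝ => k z.2 * d z.2 ^ p * ‖W (z.2, z.1)‖ₑ ^ p :=
    ((hk.mul (hd.pow_const p)).comp measurable_snd).mul
      ((hW.comp measurable_swap).enorm.pow_const p)
  calc lpMass p g
      ≤ ∫⁻ x, (∫⁻ τ, k τ * (d τ * ‖W (τ, x)‖ₑ)) ^ p :=
        lintegral_mono fun x => ENNReal.rpow_le_rpow (hg x) hp0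
    _ ≤ ∫⁻ x, (∫⁻ τ, k τ) ^ (p - 1) * ∫⁻ τ, k τ * d τ ^ p * ‖W (τ, x)‖ₑ ^ p := by
        refine lintegral_mono fun x => ?_
        refine (lintegral_mul_rpow_le hp hk (hd.mul (hWx x).enorm)).trans_eq ?_
        simp only [Pi.mul_apply, ENNReal.mul_rpow_of_nonneg _ _ hp0, mul_assoc]
    _ = _ := by
        rw [lintegral_const_mul' _ _ (ENNReal.rpow_ne_top_of_nonneg (by linarith) hkt),
          lintegral_lintegral_swap hm.aemeasurable]
        congr 1
        refine lintegral_congr fun τ => ?_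
        exact lintegral_const_mul _ ((hW.comp measurable_prodMk_left).enorm.pow_const p)

lemma continuous_one_add_sq_rpow (e : ℝ) : Continuous fun τ : ℝ => (1 + τ ^ 2) ^ e :=
  (by fun_prop : Continuous fun τ : ℝ => 1 + τ ^ 2).rpow_const fun τ => .inl (by positivity)

lemma ofReal_mul_ofReal_rpow {p a κ c : ℝ} (hp : 0 ≤ p) (hc : 0 ≤ c) (τ : ℝ) :
    ENNReal.ofReal ((1 + τ ^ 2) ^ (-(1 + κ) / 2)) *
        ENNReal.ofReal (c * (1 + τ ^ 2) ^ (-a / 2)) ^ p =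
      ENNReal.ofReal (c ^ p) * ENNReal.ofReal ((1 + τ ^ 2) ^ (-(1 + a * p + κ) / 2)) := by
  have hpos : 0 < 1 + τ ^ 2 := by positivity
  rw [ENNReal.ofReal_rpow_of_nonneg (by positivity) hp,
    ← ENNReal.ofReal_mul (by positivity), ← ENNReal.ofReal_mul (by positivity),
    Real.mul_rpow hc (by positivity), ← Real.rpow_mul hpos.le, mul_left_comm,
    ← Real.rpow_add hpos]
  congr 3
  ring

lemma exists_lpMass_mult_annSymb_le {n : ℕ} {p a κ : ℝ} (hp : 1 < p) (ha : 0 ≤ a) (hκ : 0 < κ)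
    {C₀ : ℝ≥0∞} (hC₀ : C₀ ≠ ⊤)
    (hL : ∀ g : 𝓢(V n, ℂ), ∫⁻ t in Set.Icc (1 : ℝ) 2, lpMass p (besselD (-a) (halfWave t g)) ≤
      C₀ * lpMass p g) :
    ∃ C : ℝ≥0∞, C ≠ ⊤ ∧ ∀ f : 𝓢(V n, ℂ), lpMass p (mult (annSymb (a + κ)) f) ≤ C * lpMass p f := by
  have hp0 : 0 < p := by linarith
  have haκ : 0 < a + κ := add_pos_of_nonneg_of_pos ha hκ
  obtain ⟨C, hC, hC'⟩ := exists_lintegral_weight_wave_le hp ha hκ hC₀ hL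
  obtain ⟨h, hh, ⟨c, hc0, hc⟩, hrep⟩ := exists_posRpow_one_sub_eq haκ
  have hi : Integrable h :=
    ((integrable_japanese haκ).const_mul c).mono' hh.aestronglyMeasurable (.of_forall hc)
  have hkt : ∫⁻ τ : ℝ, ENNReal.ofReal ((1 + τ ^ 2) ^ (-(1 + κ) / 2)) ≠ ⊤ :=
    (integrable_japanese hκ).lintegral_lt_top.ne
  have hk : Measurable fun τ : ℝ => ENNReal.ofReal ((1 + τ ^ 2) ^ (-(1 + κ) / 2)) :=
    (continuous_one_add_sq_rpow _).measurable.ennreal_ofReal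
  have hd : Measurable fun τ : ℝ => ENNReal.ofReal (c * (1 + τ ^ 2) ^ (-a / 2)) :=
    ((continuous_one_add_sq_rpow _).measurable.const_mul c).ennreal_ofReal
  have hkd (τ : ℝ) : ‖h τ‖ₑ ≤ ENNReal.ofReal ((1 + τ ^ 2) ^ (-(1 + κ) / 2)) *
      ENNReal.ofReal (c * (1 + τ ^ 2) ^ (-a / 2)) := by
    rw [← ofReal_norm, ← ENNReal.ofReal_mul (by positivity)]
    refine ENNReal.ofReal_le_ofReal ((hc τ).trans_eq ?_)
    rw [mul_left_comm, ← Real.rpow_add (by positivity)]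
    congr 2
    ring
  refine ⟨_, ENNReal.mul_ne_top (ENNReal.rpow_ne_top_of_nonneg (sub_pos.2 hp).le hkt)
    (ENNReal.mul_ne_top (ENNReal.ofReal_ne_top (r := c ^ p)) hC), fun f => ?_⟩
  refine (lpMass_le_of_enorm_le_lintegral hp hk hkt hd (measurable_mult_waveSymb f)
    fun x => ?_).trans ?_
  · rw [mult_annSymb_eq hi hrep]
    refine (enorm_integral_le_lintegral_enorm _).trans (lintegral_mono fun τ => ?_)
    rw [enorm_mul, ← mul_assoc]
    exact mul_le_mul_left (hkd τ) _
  · rw [mul_assoc, mul_assoc]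
    refine mul_le_mul_right ?_ _
    simp only [ofReal_mul_ofReal_rpow hp0.le hc0, mul_assoc]
    rw [lintegral_const_mul' _ _ ENNReal.ofReal_ne_top]
    exact mul_le_mul_right (hC' f) _

lemma posRpow_eq_add (δ r : ℝ) (hr : 0 ≤ r) :
    posRpow (1 - r) δ = lowProf δ r + annCut r * posRpow (1 - r) δ := by
  by_cases h : r ≤ 2
  · rw [lowProf, ← add_mul, lowCut_add_annCut (by rwa [abs_of_nonneg hr]), one_mul]
  · have : posRpow (1 - r) δ = 0 := by rw [posRpow, if_neg (by linarith)]
    simp [lowProf, this]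

lemma bochnerRiesz_eq_add {n : ℕ} {δ : ℝ} (hδ : 0 < δ) (f : 𝓢(V n, ℂ)) (x : V n) :
    bochnerRiesz δ 1 f x =
      mult (fun ξ => (lowProf δ ‖ξ‖ : ℂ)) f x + mult (annSymb δ) f x := by
  have h1 : Integrable fun ξ : V n => Complex.exp (Complex.I * ((⟪x, ξ⟫ : ℝ) : ℂ)) *
      ((lowProf δ ‖ξ‖ : ℂ) * FT f ξ) := by
    have hc : Continuous fun ξ : V n => (lowProf δ ‖ξ‖ : ℂ) :=
      Complex.continuous_ofReal.comp ((contDiff_lowProf δ).continuous.comp continuous_norm)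
    have hF := continuous_FT f
    refine Continuous.integrable_of_hasCompactSupport (by fun_prop)
      (hasCompactSupport_of_norm (R := 1) fun ξ hξ => ?_)
    rw [lowProf_eq_zero (by rw [abs_norm]; linarith)]
    simp
  have h2 : Integrable fun ξ : V n => Complex.exp (Complex.I * ((⟪x, ξ⟫ : ℝ) : ℂ)) *
      (annSymb δ ξ * FT f ξ) := by
    have hc : Continuous fun ξ : V n => annSymb δ ξ :=
      Complex.continuous_ofReal.comp ((contDiff_annCut.continuous.comp continuous_norm).mul
        ((continuous_posRpow hδ).comp (continuous_const.sub continuous_norm)))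
    have hF := continuous_FT f
    refine Continuous.integrable_of_hasCompactSupport (by fun_prop)
      (hasCompactSupport_of_norm (R := 4) fun ξ hξ => ?_)
    rw [annSymb, annCut_eq_zero_of_gt (by simpa using hξ)]
    simp
  unfold bochnerRiesz mult invFT
  rw [← mul_add, ← integral_add h1 h2]
  congr 1
  refine integral_congr_ae (.of_forall fun ξ => ?_)
  simp only [annSymb, one_mul]
  have h : ((posRpow (1 - ‖ξ‖) δ : ℝ) : ℂ) =
      (lowProf δ ‖ξ‖ : ℂ) + ((annCut ‖ξ‖ * posRpow (1 - ‖ξ‖) δ : ℝ) : ℂ) := by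
    rw [← Complex.ofReal_add]
    exact congrArg _ (posRpow_eq_add δ ‖ξ‖ (norm_nonneg ξ))
  linear_combination (Complex.exp (Complex.I * ((⟪x, ξ⟫ : ℝ) : ℂ)) * FT f ξ) * h

lemma exists_lpMass_bochnerRiesz_le {n : ℕ} (hn : 0 < n) {p a κ : ℝ} (hp : 1 < p) (ha : 0 ≤ a)
    (hκ : 0 < κ) {C₀ : ℝ≥0∞} (hC₀ : C₀ ≠ ⊤)
    (hL : ∀ g : 𝓢(V n, ℂ), ∫⁻ t in Set.Icc (1 : ℝ) 2, lpMass p (besselD (-a) (halfWave t g)) ≤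
      C₀ * lpMass p g) :
    ∃ C : ℝ≥0∞, C ≠ ⊤ ∧ ∀ f : 𝓢(V n, ℂ), lpMass p (bochnerRiesz (a + κ) 1 f) ≤ C * lpMass p f := by
  obtain ⟨A, hA, hlow⟩ := exists_lpMass_mult_low_le hn hp (a + κ)
  obtain ⟨B, hB, hhigh⟩ := exists_lpMass_mult_annSymb_le hp ha hκ hC₀ hL
  refine ⟨2 ^ (p - 1) * (A + B), by finiteness [sub_pos.2 hp], fun f => ?_⟩
  have hint : Integrable fun ξ : V n => (lowProf (a + κ) ‖ξ‖ : ℂ) * FT f ξ := by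
    have hc : Continuous fun ξ : V n => (lowProf (a + κ) ‖ξ‖ : ℂ) :=
      Complex.continuous_ofReal.comp ((contDiff_lowProf _).continuous.comp continuous_norm)
    refine (hc.mul (continuous_FT f)).integrable_of_hasCompactSupport
      (hasCompactSupport_of_norm (R := 1) fun ξ hξ => ?_)
    change (lowProf (a + κ) ‖ξ‖ : ℂ) * FT f ξ = 0
    rw [lowProf_eq_zero (by rw [abs_norm]; linarith), Complex.ofReal_zero, zero_mul]
  rw [funext (bochnerRiesz_eq_add (add_pos_of_nonneg_of_pos ha hκ) f)]
  refine (lpMass_add_le hp.le (continuous_invFT hint).measurable).trans ?_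
  rw [mul_assoc, add_mul]
  gcongr
  exacts [hlow f, hhigh f]

/-- for `n ≥ 2` and `2n/(n−1) ≤ p < ∞`, `1/p−` local smoothing for
`e^{it√(−Δ)}` implies the Bochner–Riesz estimate
`‖S^δ f‖_{L^p} ≤ C‖f‖_{L^p}` for all `δ > δ(p) = n(1/2 − 1/p) − 1/2`. -/
theorem local_smoothing_implies_bochner_riesz (n : ℕ) (hn : 2 ≤ n) (p : ℝ)
    (hp : 2 * n / (n - 1) ≤ p)
    (hLS : ∀ σ : ℝ, σ < 1 / p →
      ∃ C : ℝ, ∀ f : SchwartzMap (V n) ℂ,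
        (∫⁻ t in Set.Icc (1 : ℝ) 2,
            (eLpNorm (besselD (σ - sBar n p) (halfWave t ⇑f)) (ENNReal.ofReal p) volume)
              ^ p) ^ (1 / p)
          ≤ ENNReal.ofReal C * eLpNorm (⇑f) (ENNReal.ofReal p) volume) :
    ∀ δ : ℝ, n * (1 / 2 - 1 / p) - 1 / 2 < δ →
      ∃ C : ℝ, ∀ f : SchwartzMap (V n) ℂ,
        eLpNorm (bochnerRiesz δ 1 ⇑f) (ENNReal.ofReal p) volume
          ≤ ENNReal.ofReal C * eLpNorm (⇑f) (ENNReal.ofReal p) volume := by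
  intro δ hδ
  have hn2 : (2 : ℝ) ≤ n := by exact_mod_cast hn
  have hn1 : (0 : ℝ) < n - 1 := by linarith
  have hp2 : 2 * n ≤ p * (n - 1) := (div_le_iff₀ hn1).1 hp
  have hp1 : 2 < p := by
    by_contra! h
    nlinarith
  have hp0 : 0 < p := by linarith
  have hpi : 1 / p < 1 / 2 := one_div_lt_one_div_of_lt two_pos hp1
  have hδ0 : 0 ≤ n * (1 / 2 - 1 / p) - 1 / 2 := by
    have : n * (1 / 2 - 1 / p) - 1 / 2 = (p * (n - 1) - 2 * n) / (2 * p) := by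
      field_simp
      ring
    rw [this]
    exact div_nonneg (by linarith) (by linarith)
  set a := (n * (1 / 2 - 1 / p) - 1 / 2 + δ) / 2 with ha
  have hs : sBar n p = (n - 1) * (1 / 2 - 1 / p) := by
    rw [sBar, abs_of_pos (by linarith)]
  obtain ⟨C, hC⟩ := hLS (sBar n p - a) (by rw [hs]; linarith)
  rw [show sBar n p - a - sBar n p = -a by ring] at hC
  have hL (g : 𝓢(V n, ℂ)) : ∫⁻ t in Set.Icc (1 : ℝ) 2,
      lpMass p (besselD (-a) (halfWave t g)) ≤ ENNReal.ofReal C ^ p * lpMass p g := by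
    have h := hC g
    simp only [eLpNorm_eq_lpMass hp0, ← ENNReal.rpow_mul, one_div_mul_cancel hp0.ne',
      ENNReal.rpow_one] at h
    have h2 := ENNReal.rpow_le_rpow h hp0.le
    rwa [ENNReal.mul_rpow_of_nonneg _ _ hp0.le, ← ENNReal.rpow_mul, ← ENNReal.rpow_mul,
      one_div_mul_cancel hp0.ne', ENNReal.rpow_one, ENNReal.rpow_one] at h2
  obtain ⟨B, hB, hB'⟩ := exists_lpMass_bochnerRiesz_le (κ := δ - a) (by lia)
    (by linarith) (by linarith) (by linarith) (by finiteness) hL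
  rw [add_sub_cancel] at hB'
  refine ⟨(B ^ (1 / p)).toReal, fun f => ?_⟩
  rw [ENNReal.ofReal_toReal (by finiteness), eLpNorm_eq_lpMass hp0, eLpNorm_eq_lpMass hp0,
    ← ENNReal.mul_rpow_of_nonneg _ _ (by positivity)]
  exact ENNReal.rpow_le_rpow (hB' f) (by positivity)
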